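/- arXiv:math/0010170 — 3 statements merged into one kernel-verified Lean document; each statement's English description precedes it below -/
import Mathlib

section
/- For each j ∈ {1,2,3}, with δ = δ(j), and all real z > 0 (for j = 1 restricted to 0 < z < 2/(1-q²)), the modified q-Bessel functions satisfy the differentiation relations (2/((1+q)z)) ∂_q[z^{ν} I_{-ν}^{(j)}((1-q²)z;q²)] = q^{-((2-δ)/2)(ν-1)} z^{ν-1} I_{-ν+1}^{(j)}((1-q²) q^{(2-δ)/2} z;q²) and (2/((1+q)z)) ∂_q[z^{ν} I_ν^{(j)}((1-q²)z;q²)] = q^{-((2-δ)/2)(ν-1)} z^{ν-1} I_{ν-1}^{(j)}((1-q²) q^{(2-δ)/2} z;q²). -/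
open Real Filter

noncomputable section

/-- Finite q-Pochhammer symbol `(a;q)_n = ∏_{j=0}^{n-1} (1 - a q^j)`. -/
def qPoch (a q : ℝ) (n : ℕ) : ℝ := ∏ j ∈ Finset.range n, (1 - a * q ^ j)

/-- Infinite q-Pochhammer symbol `(a;q)_∞ = ∏_{j=0}^{∞} (1 - a q^j)`. -/
def qPochInf (a q : ℝ) : ℝ := ∏' j : ℕ, (1 - a * q ^ j)

/-- The q²-Gamma function `Γ_{q²}(x) = (q²;q²)_∞ (1-q²)^{1-x} / (q^{2x};q²)_∞`. -/
def qGamma (q x : ℝ) : ℝ :=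
  qPochInf (q ^ 2) (q ^ 2) * (1 - q ^ 2) ^ (1 - x) / qPochInf (q ^ (2 * x)) (q ^ 2)

/-- The reciprocal `1/Γ_{q²}(x)`, interpreted as `(q^{2x};q²)_∞ (1-q²)^{x-1} / (q²;q²)_∞`
(vanishing at nonpositive integers `x`). -/
def qGammaInv (q x : ℝ) : ℝ :=
  qPochInf (q ^ (2 * x)) (q ^ 2) * (1 - q ^ 2) ^ (x - 1) / qPochInf (q ^ 2) (q ^ 2)

/-- `δ(1) = 2`, `δ(2) = 0`, `δ(3) = 1`. -/
def delta : ℕ → ℝ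
  | 1 => 2
  | 2 => 0
  | 3 => 1
  | _ => 0

/-- The modified q-Bessel function of kind `j`: `Iq q j ν z = I_ν^{(j)}((1-q²)z; q²)`.
The extra power of `q` in the `k`-th term is `q^{(2-δ(j)) k (ν+k)}`, i.e. `1` for `j = 1`,
`q^{2k(ν+k)}` for `j = 2`, and `q^{k(ν+k)}` for `j = 3`. -/
def Iq (q : ℝ) (j : ℕ) (ν z : ℝ) : ℝ :=
  ∑' k : ℕ,
    q ^ ((2 - delta j) * k * (ν + k)) * (1 - q ^ 2) ^ k * (z / 2) ^ (ν + 2 * k)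
      / qPoch (q ^ 2) (q ^ 2) k * qGammaInv q (ν + k + 1)


/-- q-difference operator `∂_q f(z) = (f(z) - f(qz)) / ((1-q) z)`. -/
def qDeriv (q : ℝ) (f : ℝ → ℝ) (z : ℝ) : ℝ := (f z - f (q * z)) / ((1 - q) * z)


/-- general term of the series -/
def Tq (q c μ z : ℝ) (k : ℕ) : ℝ :=
  q ^ (c * k * (μ + k)) * (1 - q ^ 2) ^ k * (z / 2) ^ (μ + 2 * k)
      / qPoch (q ^ 2) (q ^ 2) k * qGammaInv q (μ + k + 1)

lemma Iq_eq (q : ℝ) (j : ℕ) (μ z : ℝ) : Iq q j μ z = ∑' k, Tq q (2 - delta j) μ z k := rfl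

lemma qPochInf_rec (a p : ℝ) (hp0 : 0 < p) (hp1 : p < 1) :
    qPochInf a p = (1 - a) * qPochInf (a * p) p := by
  unfold qPochInf
  have hs : Summable (fun j : ℕ => -(a * p * p ^ j)) :=
    ((summable_geometric_of_lt_one hp0.le hp1).mul_left (a * p)).neg
  have he : (fun j : ℕ => 1 - a * p ^ (j + 1)) = fun j : ℕ => 1 + -(a * p * p ^ j) := by
    funext j
    ring
  have he' : (fun j : ℕ => 1 - a * p ^ (j + 1)) = fun j : ℕ => 1 - a * p * p ^ j := by
    funext j
    ring
  have hm : Multipliable (fun j : ℕ => 1 - a * p ^ (j + 1)) := by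
    rw [he]
    exact Real.multipliable_one_add_of_summable hs
  have key := tprod_eq_zero_mul' (f := fun j : ℕ => 1 - a * p ^ j) hm
  rw [he', pow_zero, mul_one] at key
  exact key

lemma qGammaInv_rec (q x : ℝ) (hq0 : 0 < q) (hq1 : q < 1) :
    (1 - q ^ 2) * qGammaInv q x = (1 - q ^ (2 * x)) * qGammaInv q (x + 1) := by
  have h1 : 0 < 1 - q ^ 2 := by nlinarith
  unfold qGammaInv
  rw [qPochInf_rec (q ^ (2 * x)) (q ^ 2) (by positivity) (by nlinarith)]
  have e1 : q ^ (2 * (x + 1)) = q ^ (2 * x) * q ^ 2 := by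
    rw [mul_add, Real.rpow_add hq0]; norm_num
  have e2 : (1 - q ^ 2) ^ (x + 1 - 1) = (1 - q ^ 2) ^ (x - 1) * (1 - q ^ 2) := by
    rw [show x + 1 - 1 = (x - 1) + 1 by ring, Real.rpow_add h1, Real.rpow_one]
  rw [e1, e2]
  ring

lemma qPoch_succ (q : ℝ) (k : ℕ) :
    qPoch (q ^ 2) (q ^ 2) (k + 1) = qPoch (q ^ 2) (q ^ 2) k * (1 - q ^ (2 * (k + 1))) := by
  unfold qPoch
  rw [Finset.prod_range_succ]
  congr 2
  ring

lemma one_sub_pos' (q : ℝ) (hq0 : 0 < q) (hq1 : q < 1) (k : ℕ) : 0 < 1 - q ^ (2 * (k + 1)) := by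
  have := pow_lt_one₀ hq0.le hq1 (n := 2 * (k + 1)) (by omega)
  linarith

lemma qPoch_ne (q : ℝ) (hq0 : 0 < q) (hq1 : q < 1) (k : ℕ) : qPoch (q ^ 2) (q ^ 2) k ≠ 0 := by
  induction k with
  | zero => simp [qPoch]
  | succ k ih =>
    rw [qPoch_succ]
    exact mul_ne_zero ih (one_sub_pos' q hq0 hq1 k).ne'

lemma Tq_exp (q c μ z : ℝ) (k : ℕ) (hq0 : 0 < q) (hz : 0 < z) :
    Tq q c μ z k = exp (log q * (c * k * (μ + k)) + (log z - log 2) * (μ + 2 * k))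
      * ((1 - q ^ 2) ^ k / qPoch (q ^ 2) (q ^ 2) k * qGammaInv q (μ + k + 1)) := by
  unfold Tq
  rw [Real.rpow_def_of_pos hq0, Real.rpow_def_of_pos (by positivity : 0 < z / 2),
    Real.log_div hz.ne' (by norm_num), Real.exp_add]
  ring

lemma Tq_scale (q c μ ν z : ℝ) (k : ℕ) (hq0 : 0 < q) (hz : 0 < z) :
    (q * z) ^ ν * Tq q c μ (q * z) k = q ^ (ν + μ + 2 * k) * (z ^ ν * Tq q c μ z k) := by
  rw [Tq_exp q c μ z k hq0 hz, Tq_exp q c μ (q * z) k hq0 (by positivity),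
    Real.rpow_def_of_pos hq0, Real.rpow_def_of_pos hz, Real.rpow_def_of_pos (by positivity),
    Real.log_mul hq0.ne' hz.ne']
  simp only [← mul_assoc, ← Real.exp_add]
  congr 3
  ring

lemma Tq_rec (q c μ z : ℝ) (k : ℕ) (hq0 : 0 < q) (hq1 : q < 1) (hz : 0 < z) :
    (1 - q ^ (2 * (μ + k + 1))) * (1 - q ^ (2 * (k + 1))) * Tq q c μ z (k + 1)
      = q ^ (c * (2 * k + 1 + μ)) * ((1 - q ^ 2) * (z / 2)) ^ 2 * Tq q c μ z k := by
  have hg := qGammaInv_rec q (μ + k + 1) hq0 hq1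
  have hp := qPoch_ne q hq0 hq1 k
  have hk := (one_sub_pos' q hq0 hq1 k).ne'
  have e1 : q ^ (c * ((k + 1 : ℕ) : ℝ) * (μ + ((k + 1 : ℕ) : ℝ)))
      = q ^ (c * k * (μ + k)) * q ^ (c * (2 * k + 1 + μ)) := by
    rw [← Real.rpow_add hq0]; congr 1; push_cast; ring
  have e2 : (z / 2) ^ (μ + 2 * ((k + 1 : ℕ) : ℝ)) = (z / 2) ^ (μ + 2 * k) * (z / 2) ^ 2 := by
    rw [← Real.rpow_natCast (z / 2) 2, ← Real.rpow_add (by positivity)]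
    congr 1; push_cast; ring
  unfold Tq
  rw [e1, e2, qPoch_succ, pow_succ (1 - q ^ 2) k,
    show μ + ((k + 1 : ℕ) : ℝ) + 1 = μ + k + 1 + 1 by push_cast; ring]
  generalize q ^ (2 * (μ + k + 1)) = A at *
  field_simp
  linear_combination (-(1 - q ^ 2) ^ (k + 1)) * hg

lemma Tq_summable (q c μ z : ℝ) (hq0 : 0 < q) (hq1 : q < 1) (hz : 0 < z) (hc : 0 ≤ c)
    (hc0 : c = 0 → z < 2 / (1 - q ^ 2)) : Summable (Tq q c μ z) := by
  have h1 : 0 < 1 - q ^ 2 := by nlinarith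
  have hlin : ∀ a b : ℝ, 0 < a → Tendsto (fun k : ℕ => q ^ (a * k + b)) atTop (nhds 0) := by
    intro a b ha
    refine (tendsto_rpow_atTop_of_base_lt_one q (by linarith) hq1).comp ?_
    exact tendsto_atTop_add_const_right _ _ (tendsto_natCast_atTop_atTop.const_mul_atTop ha)
  have hA : Tendsto (fun k : ℕ => q ^ (2 * (μ + k + 1))) atTop (nhds 0) :=
    (hlin 2 (2 * μ + 2) (by norm_num)).congr (fun k => by congr 1; ring)
  have hB : Tendsto (fun k : ℕ => q ^ (2 * (k + 1))) atTop (nhds 0) :=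
    (tendsto_pow_atTop_nhds_zero_of_lt_one hq0.le hq1).comp
      (tendsto_atTop_mono (fun k => by simp only [id]; omega) tendsto_id)
  have hL : ∃ L : ℝ, L < 1 ∧ Tendsto (fun k : ℕ => q ^ (c * (2 * k + 1 + μ))
      * ((1 - q ^ 2) * (z / 2)) ^ 2) atTop (nhds L) := by
    rcases hc.eq_or_lt with h | h
    · subst h
      refine ⟨((1 - q ^ 2) * (z / 2)) ^ 2, ?_, by simp⟩
      have := hc0 rfl
      rw [lt_div_iff₀ h1] at this
      have h2 : (1 - q ^ 2) * (z / 2) < 1 := by linarith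
      exact pow_lt_one₀ (by positivity) h2 (by norm_num)
    · refine ⟨0, by norm_num, ?_⟩
      have := ((hlin (2 * c) (c * (1 + μ)) (by positivity)).congr
        (fun k => by congr 1; ring : ∀ k : ℕ, q ^ (2 * c * k + c * (1 + μ))
          = q ^ (c * (2 * k + 1 + μ)))).mul_const (((1 - q ^ 2) * (z / 2)) ^ 2)
      simpa using this
  obtain ⟨L, hL1, hL⟩ := hL
  obtain ⟨r, hr, hr1⟩ := exists_between hL1
  have hden : Tendsto (fun k : ℕ => (1 - q ^ (2 * (μ + k + 1))) * (1 - q ^ (2 * (k + 1))))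
      atTop (nhds 1) := by
    simpa using (hA.const_sub 1).mul (hB.const_sub 1)
  have hrat := hL.div hden (by norm_num)
  rw [div_one] at hrat
  refine summable_of_ratio_norm_eventually_le hr1 ?_
  filter_upwards [hrat.eventually_lt_const hr, hden.eventually_const_lt (show (0:ℝ) < 1 by norm_num)]
    with k hk1 hk2
  have hrec := Tq_rec q c μ z k hq0 hq1 hz
  have : Tq q c μ z (k + 1) = (q ^ (c * (2 * k + 1 + μ)) * ((1 - q ^ 2) * (z / 2)) ^ 2
      / ((1 - q ^ (2 * (μ + k + 1))) * (1 - q ^ (2 * (k + 1))))) * Tq q c μ z k := by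
    rw [div_mul_eq_mul_div, eq_div_iff hk2.ne']
    linarith
  rw [this, norm_mul]
  refine mul_le_mul_of_nonneg_right ?_ (norm_nonneg _)
  rw [Real.norm_of_nonneg (by positivity)]
  exact hk1.le

lemma lhs_series (q c μ ν z : ℝ) (hq0 : 0 < q) (hq1 : q < 1) (hz : 0 < z) (hc : 0 ≤ c)
    (hc0 : c = 0 → z < 2 / (1 - q ^ 2)) :
    HasSum (fun k : ℕ => 2 / ((1 - q ^ 2) * z ^ 2) * ((1 - q ^ (ν + μ + 2 * k))
        * (z ^ ν * Tq q c μ z k)))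
      (2 / ((1 + q) * z) * qDeriv q (fun w => w ^ ν * ∑' k, Tq q c μ w k) z) := by
  have s1 := (Tq_summable q c μ z hq0 hq1 hz hc hc0).hasSum.mul_left (z ^ ν)
  have s2 := (Tq_summable q c μ (q * z) hq0 hq1 (by positivity) hc
    (fun h => lt_of_le_of_lt (by nlinarith) (hc0 h))).hasSum.mul_left ((q * z) ^ ν)
  have h3 : 1 - q ≠ 0 := by linarith
  have h4 : 1 + q ≠ 0 := by linarith
  have s3 := (s1.sub s2).mul_left (2 / ((1 - q ^ 2) * z ^ 2))
  have e : 2 / ((1 + q) * z) * qDeriv q (fun w => w ^ ν * ∑' k, Tq q c μ w k) z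
      = 2 / ((1 - q ^ 2) * z ^ 2) * (z ^ ν * ∑' k, Tq q c μ z k
        - (q * z) ^ ν * ∑' k, Tq q c μ (q * z) k) := by
    unfold qDeriv
    rw [show 1 - q ^ 2 = (1 - q) * (1 + q) by ring]
    field_simp
  rw [e]
  refine (congrArg (fun f => HasSum f _) ?_).mpr s3
  funext k
  rw [Tq_scale q c μ ν z k hq0 hz]
  ring

lemma rel1 (q c ν z : ℝ) (hq0 : 0 < q) (hq1 : q < 1) (hz : 0 < z) (hc : 0 ≤ c)
    (hc0 : c = 0 → z < 2 / (1 - q ^ 2)) :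
    2 / ((1 + q) * z) * qDeriv q (fun w => w ^ ν * ∑' k, Tq q c (-ν) w k) z
      = q ^ (-(c / 2) * (ν - 1)) * z ^ (ν - 1)
          * ∑' k, Tq q c (-ν + 1) (q ^ (c / 2) * z) k := by
  have h := lhs_series q c (-ν) ν z hq0 hq1 hz hc hc0
  have h1 : 0 < 1 - q ^ 2 := by nlinarith
  rw [← h.tsum_eq, h.summable.tsum_eq_zero_add, ← tsum_mul_left]
  simp only [Nat.cast_zero, mul_zero, add_zero, add_neg_cancel, Real.rpow_zero, sub_self,
    zero_mul, zero_add]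
  refine tsum_congr ?_
  intro k
  have hp := qPoch_ne q hq0 hq1 k
  have hk := (one_sub_pos' q hq0 hq1 k).ne'
  have e0 : q ^ (2 * ((k + 1 : ℕ) : ℝ)) = q ^ (2 * (k + 1)) := by
    rw [← Real.rpow_natCast]; congr 1; push_cast; ring
  rw [Tq_exp _ _ _ _ _ hq0 hz, Tq_exp _ _ _ _ _ hq0 (by positivity), e0, qPoch_succ,
    show -ν + ((k + 1 : ℕ) : ℝ) + 1 = -ν + 1 + k + 1 by push_cast; ring,
    Real.log_mul (by positivity) hz.ne', Real.log_rpow hq0, pow_succ (1 - q ^ 2) k]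
  have key : 2 / z ^ 2 * (z ^ ν * exp (log q * (c * ((k + 1 : ℕ) : ℝ) * (-ν + ((k + 1 : ℕ) : ℝ)))
        + (log z - log 2) * (-ν + 2 * ((k + 1 : ℕ) : ℝ))))
      = q ^ (-(c / 2) * (ν - 1)) * z ^ (ν - 1) * exp (log q * (c * k * (-ν + 1 + k))
        + (c / 2 * log q + log z - log 2) * (-ν + 1 + 2 * k)) := by
    have : (2 : ℝ) / z ^ 2 = exp (log 2 - 2 * log z) := by
      rw [Real.exp_sub, Real.exp_log (by norm_num), two_mul, Real.exp_add, Real.exp_log hz, sq]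
    rw [this, Real.rpow_def_of_pos hq0, Real.rpow_def_of_pos hz, Real.rpow_def_of_pos hz]
    simp only [← mul_assoc, ← Real.exp_add]
    congr 1
    push_cast
    ring
  rw [← mul_assoc (q ^ (-(c / 2) * (ν - 1)) * z ^ (ν - 1)), ← key]
  field_simp

lemma rel2 (q c ν z : ℝ) (hq0 : 0 < q) (hq1 : q < 1) (hz : 0 < z) (hc : 0 ≤ c)
    (hc0 : c = 0 → z < 2 / (1 - q ^ 2)) :
    2 / ((1 + q) * z) * qDeriv q (fun w => w ^ ν * ∑' k, Tq q c ν w k) z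
      = q ^ (-(c / 2) * (ν - 1)) * z ^ (ν - 1)
          * ∑' k, Tq q c (ν - 1) (q ^ (c / 2) * z) k := by
  have h := lhs_series q c ν ν z hq0 hq1 hz hc hc0
  have h1 : 0 < 1 - q ^ 2 := by nlinarith
  rw [← h.tsum_eq, ← tsum_mul_left]
  refine tsum_congr ?_
  intro k
  have hp := qPoch_ne q hq0 hq1 k
  have hg := qGammaInv_rec q (ν + k) hq0 hq1
  rw [Tq_exp _ _ _ _ _ hq0 hz, Tq_exp _ _ _ _ _ hq0 (by positivity),
    show ν + ν + 2 * (k : ℝ) = 2 * (ν + k) by ring,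
    show ν - 1 + (k : ℝ) + 1 = ν + k by ring,
    Real.log_mul (by positivity) hz.ne', Real.log_rpow hq0]
  have key : 2 / z ^ 2 * (z ^ ν * exp (log q * (c * k * (ν + k))
        + (log z - log 2) * (ν + 2 * k)))
      = q ^ (-(c / 2) * (ν - 1)) * z ^ (ν - 1) * exp (log q * (c * k * (ν - 1 + k))
        + (c / 2 * log q + log z - log 2) * (ν - 1 + 2 * k)) := by
    have : (2 : ℝ) / z ^ 2 = exp (log 2 - 2 * log z) := by
      rw [Real.exp_sub, Real.exp_log (by norm_num), two_mul, Real.exp_add, Real.exp_log hz, sq]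
    rw [this, Real.rpow_def_of_pos hq0, Real.rpow_def_of_pos hz, Real.rpow_def_of_pos hz]
    simp only [← mul_assoc, ← Real.exp_add]
    congr 1
    ring
  have hg' : qGammaInv q (ν + k) = (1 - q ^ (2 * (ν + k))) * qGammaInv q (ν + k + 1)
      / (1 - q ^ 2) := by
    rw [eq_div_iff h1.ne']; linarith
  rw [← mul_assoc (q ^ (-(c / 2) * (ν - 1)) * z ^ (ν - 1)), ← key, hg']
  field_simp

/-- differentiation relations for the modified q-Bessel functions. -/
theorem stmt1 (q ν : ℝ) (hq0 : 0 < q) (hq1 : q < 1)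
    (j : ℕ) (hj : j = 1 ∨ j = 2 ∨ j = 3)
    (z : ℝ) (hz : 0 < z) (hz1 : j = 1 → z < 2 / (1 - q ^ 2)) :
    2 / ((1 + q) * z) * qDeriv q (fun w => w ^ ν * Iq q j (-ν) w) z
      = q ^ (-((2 - delta j) / 2) * (ν - 1)) * z ^ (ν - 1)
          * Iq q j (-ν + 1) (q ^ ((2 - delta j) / 2) * z)
  ∧ 2 / ((1 + q) * z) * qDeriv q (fun w => w ^ ν * Iq q j ν w) z
      = q ^ (-((2 - delta j) / 2) * (ν - 1)) * z ^ (ν - 1)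
          * Iq q j (ν - 1) (q ^ ((2 - delta j) / 2) * z) := by
  simp only [Iq_eq]
  have hc : 0 ≤ 2 - delta j := by
    rcases hj with rfl | rfl | rfl <;> norm_num [delta]
  have hc0 : 2 - delta j = 0 → z < 2 / (1 - q ^ 2) := by
    rcases hj with rfl | rfl | rfl
    · exact fun _ => hz1 rfl
    · norm_num [delta]
    · norm_num [delta]
  exact ⟨rel1 q _ ν z hq0 hq1 hz hc hc0, rel2 q _ ν z hq0 hq1 hz hc hc0⟩

end
end

section
/- For ν ∈ ℝ, define g(z) = I_ν^{(2)}((1-q²)z;q²) / ((1-q²)² z²/4; q²)_∞ for all real z > 0 with z ≠ 2q^{-r}/(1-q²) for every integer r ≥ 0. Then g(z) = I_ν^{(1)}((1-q²)z;q²) for 0 < z < 2/(1-q²), and g has a simple pole at each point z_r = 2q^{-r}/(1-q²), r = 0, 1, 2, ...; that is, the limit lim_{z→z_r} (z - z_r)·g(z) exists and is nonzero (in particular I_ν^{(2)}((1-q²)z_r;q²) ≠ 0). -/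
open Real Filter

noncomputable section

/-- The meromorphic continuation `g(z) = I_ν^{(2)}((1-q²)z;q²) / ((1-q²)²z²/4; q²)_∞`. -/
def gfun (q ν z : ℝ) : ℝ :=
  Iq q 2 ν z / qPochInf ((1 - q ^ 2) ^ 2 * z ^ 2 / 4) (q ^ 2)


section helpers

open Topology

lemma qs_summable {p : ℝ} (hp0 : 0 < p) (hp1 : p < 1) (x : ℝ) :
    Summable fun j : ℕ => ‖-(x * p ^ j)‖ := by
  have h := (summable_geometric_of_lt_one hp0.le hp1).mul_left |x|
  refine h.congr fun j => ?_
  rw [norm_neg, norm_mul, norm_pow, Real.norm_eq_abs, Real.norm_eq_abs, abs_of_pos hp0]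

lemma qs_multipliable {p : ℝ} (hp0 : 0 < p) (hp1 : p < 1) (x : ℝ) :
    Multipliable fun j : ℕ => (1 - x * p ^ j) := by
  simpa [sub_eq_add_neg] using multipliable_one_add_of_summable (qs_summable hp0 hp1 x)

lemma qs_split {p : ℝ} (hp0 : 0 < p) (hp1 : p < 1) (x : ℝ) (n : ℕ) :
    qPochInf x p = qPoch x p n * qPochInf (x * p ^ n) p := by
  have h := qs_multipliable hp0 hp1 (x * p ^ n)
  have h2 : (fun j : ℕ => 1 - x * p ^ n * p ^ j) = fun j => 1 - x * p ^ (j + n) := by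
    funext j; rw [pow_add]; ring
  rw [h2] at h
  have := Multipliable.prod_mul_tprod_nat_mul' (f := fun j : ℕ => 1 - x * p ^ j) h
  unfold qPochInf qPoch
  rw [h2, ← this]

lemma qs_ne {p : ℝ} (hp0 : 0 < p) (hp1 : p < 1) {x : ℝ} (hx0 : 0 ≤ x) (hx1 : x < 1) :
    qPochInf x p ≠ 0 := by
  have := tprod_one_add_ne_zero_of_summable (f := fun j : ℕ => -(x * p ^ j)) (fun j => ?_)
    (qs_summable hp0 hp1 x)
  · simpa [sub_eq_add_neg, qPochInf] using this
  · have h1 : p ^ j ≤ 1 := pow_le_one₀ hp0.le hp1.le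
    have h2 : 0 < p ^ j := pow_pos hp0 j
    nlinarith

lemma qs_poch_ne {p : ℝ} (hp0 : 0 < p) (hp1 : p < 1) (k : ℕ) : qPoch p p k ≠ 0 := by
  intro h
  have := qs_split hp0 hp1 p k
  rw [h, zero_mul] at this
  exact qs_ne hp0 hp1 hp0.le hp1 this

lemma qs_cont {p : ℝ} (hp0 : 0 < p) (hp1 : p < 1) : Continuous fun x => qPochInf x p := by
  rw [continuous_iff_continuousAt]
  intro x
  have hu := (summable_geometric_of_lt_one hp0.le hp1).mul_left (|x| + 1)
  have h := Summable.hasProdLocallyUniformlyOn_nat_one_add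
    (f := fun (j : ℕ) (y : ℝ) => -(y * p ^ j)) (K := Metric.ball 0 (|x| + 1))
    Metric.isOpen_ball hu (Eventually.of_forall fun n y hy => ?_)
    (fun n => by fun_prop)
  · rw [hasProdLocallyUniformlyOn_iff_tendstoLocallyUniformlyOn] at h
    have h3 := h.continuousOn (Frequently.of_forall fun s => by fun_prop)
    have h4 := h3.continuousAt (x := x) (Metric.isOpen_ball.mem_nhds (by simp))
    simpa [qPochInf, sub_eq_add_neg] using h4
  · rw [norm_neg, norm_mul, norm_pow, Real.norm_eq_abs p, abs_of_pos hp0]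
    have : ‖y‖ ≤ |x| + 1 := by
      have := Metric.mem_ball.1 hy
      rw [dist_zero_right] at this
      exact this.le
    gcongr

lemma qs_tendsto {p : ℝ} (hp0 : 0 < p) (hp1 : p < 1) (x : ℝ) :
    Tendsto (fun n => qPoch x p n) atTop (𝓝 (qPochInf x p)) :=
  (qs_multipliable hp0 hp1 x).hasProd.tendsto_prod_nat

lemma qs_zero (p : ℝ) : qPochInf 0 p = 1 := by simp [qPochInf]

lemma qs_bound {p : ℝ} (hp0 : 0 < p) (hp1 : p < 1) (a0 : ℝ) :
    ∃ C : ℝ, 0 ≤ C ∧ ∀ a ∈ Set.Icc 0 a0, ∀ k : ℕ,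
      |qPochInf (a * p ^ k) p / qPoch p p k| ≤ C := by
  have h1 := ((qs_tendsto hp0 hp1 p).inv₀ (qs_ne hp0 hp1 hp0.le hp1)).norm.bddAbove_range
  obtain ⟨C1, hC1⟩ := h1
  obtain ⟨C2, hC2⟩ := (isCompact_Icc (a := (0:ℝ)) (b := a0)).exists_bound_of_continuousOn
    (qs_cont hp0 hp1).continuousOn
  have hC1' : ∀ k, ‖(qPoch p p k)⁻¹‖ ≤ C1 := fun k => hC1 ⟨k, rfl⟩
  have hC10 : 0 ≤ C1 := (norm_nonneg _).trans (hC1' 0)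
  refine ⟨|C2| * C1, by positivity, fun a ha k => ?_⟩
  rw [div_eq_mul_inv, abs_mul]
  have hk1 : p ^ k ≤ 1 := pow_le_one₀ hp0.le hp1.le
  have hk0 : 0 < p ^ k := pow_pos hp0 k
  have h2 := hC2 (a * p ^ k) ⟨mul_nonneg ha.1 hk0.le, by nlinarith [ha.1, ha.2]⟩
  exact mul_le_mul (h2.trans (le_abs_self _)) (hC1' k) (abs_nonneg _) (abs_nonneg _)

/-- reduced series of the first kind -/
def qsA (p a w : ℝ) : ℝ := ∑' k : ℕ, w ^ k * (qPochInf (a * p ^ k) p / qPoch p p k)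

/-- reduced series of the second kind -/
def qsB (p a w : ℝ) : ℝ :=
  ∑' k : ℕ, p ^ (k * (k - 1)) * (a * w) ^ k * (qPochInf (a * p ^ k) p / qPoch p p k)

lemma qs_gauss {p : ℝ} (hp0 : 0 < p) (hp1 : p < 1) (R : ℝ) :
    Summable fun k : ℕ => p ^ (k * (k - 1)) * R ^ k := by
  by_cases hR : R = 0
  · refine summable_of_ne_finset_zero (s := {0}) fun b hb => ?_
    simp at hb
    simp [hR, hb]
  refine summable_of_ratio_test_tendsto_lt_one (l := 0) one_pos
    (Eventually.of_forall fun n => by positivity) ?_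
  have h : ∀ n : ℕ, ‖p ^ ((n + 1) * (n + 1 - 1)) * R ^ (n + 1)‖ / ‖p ^ (n * (n - 1)) * R ^ n‖
      = |R| * (p ^ 2) ^ n := by
    intro n
    have e : (n + 1) * (n + 1 - 1) = n * (n - 1) + 2 * n := by
      cases n <;> simp; ring
    rw [e, pow_add, pow_succ]
    simp only [norm_mul, norm_pow, Real.norm_eq_abs, abs_of_pos hp0]
    have : |R| ≠ 0 := abs_ne_zero.2 hR
    field_simp
    rw [pow_mul]
  simp_rw [h]
  have := (tendsto_pow_atTop_nhds_zero_of_lt_one (r := p ^ 2) (by positivity)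
    (by nlinarith)).const_mul |R|
  simpa using this

lemma qsA_bd {p : ℝ} (hp0 : 0 < p) (hp1 : p < 1) (a0 w0 : ℝ) (hw1 : w0 < 1) :
    ∃ u : ℕ → ℝ, Summable u ∧ ∀ (k : ℕ), ∀ x ∈ Set.Icc (0:ℝ) a0 ×ˢ Set.Icc (0:ℝ) w0,
      ‖x.2 ^ k * (qPochInf (x.1 * p ^ k) p / qPoch p p k)‖ ≤ u k := by
  obtain ⟨C, hC0, hC⟩ := qs_bound hp0 hp1 a0
  by_cases hw : 0 ≤ w0
  · refine ⟨_, (summable_geometric_of_lt_one hw hw1).mul_right C, fun k x hx => ?_⟩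
    rw [norm_mul, norm_pow]
    have : ‖x.2‖ ≤ w0 := by rw [Real.norm_eq_abs, abs_of_nonneg hx.2.1]; exact hx.2.2
    exact mul_le_mul (by gcongr) (hC _ hx.1 k) (norm_nonneg _) (by positivity)
  · exact ⟨0, summable_zero, fun k x hx => absurd (hx.2.1.trans hx.2.2) hw⟩

lemma qsB_bd {p : ℝ} (hp0 : 0 < p) (hp1 : p < 1) (a0 w0 : ℝ) :
    ∃ u : ℕ → ℝ, Summable u ∧ ∀ (k : ℕ), ∀ x ∈ Set.Icc (0:ℝ) a0 ×ˢ Set.Icc (0:ℝ) w0,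
      ‖p ^ (k * (k - 1)) * (x.1 * x.2) ^ k * (qPochInf (x.1 * p ^ k) p / qPoch p p k)‖ ≤ u k := by
  obtain ⟨C, hC0, hC⟩ := qs_bound hp0 hp1 a0
  refine ⟨_, (qs_gauss hp0 hp1 (|a0| * |w0|)).mul_right C, fun k x hx => ?_⟩
  rw [norm_mul, norm_mul, norm_pow, norm_pow, norm_mul, Real.norm_eq_abs p, abs_of_pos hp0]
  have h1 : ‖x.1‖ ≤ |a0| := by
    rw [Real.norm_eq_abs, abs_of_nonneg hx.1.1]; exact hx.1.2.trans (le_abs_self _)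
  have h2 : ‖x.2‖ ≤ |w0| := by
    rw [Real.norm_eq_abs, abs_of_nonneg hx.2.1]; exact hx.2.2.trans (le_abs_self _)
  exact mul_le_mul (by gcongr) (hC _ hx.1 k) (norm_nonneg _) (by positivity)

lemma qsA_cont {p : ℝ} (hp0 : 0 < p) (hp1 : p < 1) (a0 w0 : ℝ) (hw1 : w0 < 1) :
    ContinuousOn (fun x : ℝ × ℝ => qsA p x.1 x.2) (Set.Icc (0:ℝ) a0 ×ˢ Set.Icc (0:ℝ) w0) := by
  obtain ⟨u, hu, hb⟩ := qsA_bd hp0 hp1 a0 w0 hw1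
  refine continuousOn_tsum (fun k => ?_) hu hb
  have := qs_cont hp0 hp1
  exact Continuous.continuousOn (by fun_prop)

lemma qsB_cont {p : ℝ} (hp0 : 0 < p) (hp1 : p < 1) (a0 w0 : ℝ) :
    ContinuousOn (fun x : ℝ × ℝ => qsB p x.1 x.2) (Set.Icc (0:ℝ) a0 ×ˢ Set.Icc (0:ℝ) w0) := by
  obtain ⟨u, hu, hb⟩ := qsB_bd hp0 hp1 a0 w0
  refine continuousOn_tsum (fun k => ?_) hu hb
  have := qs_cont hp0 hp1
  exact Continuous.continuousOn (by fun_prop)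

lemma qsA_summable {p : ℝ} (hp0 : 0 < p) (hp1 : p < 1) {a w : ℝ} (ha : 0 ≤ a) (hw0 : 0 ≤ w)
    (hw1 : w < 1) :
    Summable fun k : ℕ => w ^ k * (qPochInf (a * p ^ k) p / qPoch p p k) := by
  obtain ⟨u, hu, hb⟩ := qsA_bd hp0 hp1 a w hw1
  exact hu.of_norm_bounded fun k => hb k (a, w) ⟨⟨ha, le_rfl⟩, ⟨hw0, le_rfl⟩⟩

lemma qsB_summable {p : ℝ} (hp0 : 0 < p) (hp1 : p < 1) {a w : ℝ} (ha : 0 ≤ a) (hw0 : 0 ≤ w) :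
    Summable fun k : ℕ =>
      p ^ (k * (k - 1)) * (a * w) ^ k * (qPochInf (a * p ^ k) p / qPoch p p k) := by
  obtain ⟨u, hu, hb⟩ := qsB_bd hp0 hp1 a w
  exact hu.of_norm_bounded fun k => hb k (a, w) ⟨⟨ha, le_rfl⟩, ⟨hw0, le_rfl⟩⟩

lemma qs_step {p : ℝ} (hp0 : 0 < p) (hp1 : p < 1) (a : ℝ) (k : ℕ) :
    qPochInf (a * p ^ k) p = (1 - a * p ^ k) * qPochInf (a * p * p ^ k) p := by
  have := qs_split hp0 hp1 (a * p ^ k) 1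
  rw [this]
  simp only [qPoch, Finset.prod_range_one, pow_zero, mul_one, pow_one]
  ring_nf

lemma qs_poch_succ (p : ℝ) (k : ℕ) : qPoch p p (k + 1) = qPoch p p k * (1 - p ^ (k + 1)) := by
  rw [qPoch, Finset.prod_range_succ, ← qPoch, pow_succ']

lemma qsA_rec {p : ℝ} (hp0 : 0 < p) (hp1 : p < 1) {a w : ℝ} (ha : 0 ≤ a) (hw0 : 0 ≤ w)
    (hw1 : w < 1) : qsA p a w = qsA p (a * p) w - a * qsA p (a * p) (p * w) := by
  have hap : 0 ≤ a * p := by positivity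
  have hpw : p * w < 1 := by nlinarith
  unfold qsA
  rw [← tsum_mul_left, ← (qsA_summable hp0 hp1 hap hw0 hw1).tsum_sub
    ((qsA_summable hp0 hp1 hap (by positivity) hpw).mul_left a)]
  refine tsum_congr fun k => ?_
  rw [qs_step hp0 hp1 a k, mul_pow]
  ring

lemma qsB_rec {p : ℝ} (hp0 : 0 < p) (hp1 : p < 1) {a w : ℝ} (ha : 0 ≤ a) (hw0 : 0 ≤ w) :
    qsB p a w = qsB p (a * p) w - a * (1 - w) * qsB p (a * p) (p * w) := by
  have hap : 0 ≤ a * p := by positivity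
  have hpw : 0 ≤ p * w := by positivity
  have s1 := qsB_summable hp0 hp1 hap hw0
  have s2 := qsB_summable hp0 hp1 hap hpw
  set f : ℕ → ℝ := fun k => p ^ (k * (k - 1)) * (a * w) ^ k *
    (qPochInf (a * p ^ k) p / qPoch p p k) * (1 - p ^ k) with hf
  have f0 : f 0 = 0 := by simp [hf]
  have fs : ∀ k, f (k + 1) = a * w * (p ^ (k * (k - 1)) * (a * p * (p * w)) ^ k *
      (qPochInf (a * p * p ^ k) p / qPoch p p k)) := by
    intro k
    have hk := qs_poch_ne hp0 hp1 k
    have hk1 := qs_poch_ne hp0 hp1 (k + 1)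
    rw [qs_poch_succ] at hk1
    have hk2 := right_ne_zero_of_mul hk1
    have e : (k + 1) * (k + 1 - 1) = k * (k - 1) + 2 * k := by
      cases k <;> simp; ring
    have e2 : a * p ^ (k + 1) = a * p * p ^ k := by ring
    simp only [hf]
    rw [qs_poch_succ, e, pow_add, e2]
    field_simp
    ring
  have hsf1 : Summable fun k => f (k + 1) := by
    simp_rw [fs]; exact s2.mul_left _
  have hsf : Summable f := (summable_nat_add_iff 1).1 hsf1
  have ht : ∑' k, f k = a * w * qsB p (a * p) (p * w) := by
    rw [hsf.tsum_eq_zero_add, f0, zero_add]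
    simp_rw [fs]
    rw [tsum_mul_left]; rfl
  have hmain : qsB p a w = qsB p (a * p) w + ∑' k, f k - a * qsB p (a * p) (p * w) := by
    unfold qsB
    rw [← tsum_mul_left, ← s1.tsum_add hsf, ← (s1.add hsf).tsum_sub (s2.mul_left a)]
    refine tsum_congr fun k => ?_
    simp only [hf]
    rw [qs_step hp0 hp1 a k]
    simp only [mul_pow]
    ring
  rw [hmain, ht]; ring

lemma qsA_euler_step {p : ℝ} (hp0 : 0 < p) (hp1 : p < 1) {w : ℝ} (hw0 : 0 ≤ w) (hw1 : w < 1) :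
    qsA p 0 w * (1 - w) = qsA p 0 (p * w) := by
  have s1 := qsA_summable hp0 hp1 le_rfl hw0 hw1
  have s2 := qsA_summable hp0 hp1 (a := 0) (w := p * w) le_rfl (by positivity) (by nlinarith)
  have h : qsA p 0 w - qsA p 0 (p * w) = w * qsA p 0 w := by
    unfold qsA
    rw [← s1.tsum_sub s2, (s1.sub s2).tsum_eq_zero_add, ← tsum_mul_left]
    simp only [pow_zero, sub_self, zero_add]
    refine tsum_congr fun k => ?_
    have hk := qs_poch_ne hp0 hp1 k
    have hk1 := qs_poch_ne hp0 hp1 (k + 1)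
    rw [qs_poch_succ] at hk1
    have hk2 := right_ne_zero_of_mul hk1
    rw [qs_poch_succ]
    simp only [zero_mul]
    field_simp
    ring
  linarith

lemma qsA_at_zero (p : ℝ) : qsA p 0 0 = 1 := by
  unfold qsA
  rw [tsum_eq_single 0 (fun k hk => by simp [hk])]
  simp [qs_zero, qPoch]

lemma qsB_at_zero (p w : ℝ) : qsB p 0 w = 1 := by
  unfold qsB
  rw [tsum_eq_single 0 (fun k hk => by simp [hk])]
  simp [qs_zero, qPoch]

lemma qsA_euler {p : ℝ} (hp0 : 0 < p) (hp1 : p < 1) {w : ℝ} (hw0 : 0 ≤ w) (hw1 : w < 1) :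
    qPochInf w p * qsA p 0 w = 1 := by
  have hle : ∀ n : ℕ, 0 ≤ w * p ^ n ∧ w * p ^ n ≤ w := fun n =>
    ⟨by positivity, mul_le_of_le_one_right hw0 (pow_le_one₀ hp0.le hp1.le)⟩
  have h : ∀ n, qPoch w p n * qsA p 0 w = qsA p 0 (w * p ^ n) := by
    intro n
    induction n with
    | zero => simp [qPoch]
    | succ n ih =>
      rw [qPoch, Finset.prod_range_succ, ← qPoch, pow_succ, mul_right_comm, ih,
        qsA_euler_step hp0 hp1 (hle n).1 ((hle n).2.trans_lt hw1)]
      ring_nf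
  have t1 := (qs_tendsto hp0 hp1 w).mul_const (qsA p 0 w)
  have hc := qsA_cont hp0 hp1 0 w hw1
  have t3 : Tendsto (fun n : ℕ => ((0:ℝ), w * p ^ n)) atTop
      (𝓝[Set.Icc (0:ℝ) 0 ×ˢ Set.Icc (0:ℝ) w] (0, 0)) := by
    refine tendsto_nhdsWithin_iff.2 ⟨?_, Eventually.of_forall fun n => ?_⟩
    · have := (tendsto_pow_atTop_nhds_zero_of_lt_one hp0.le hp1).const_mul w
      rw [mul_zero] at this
      exact tendsto_const_nhds.prodMk_nhds this
    · exact ⟨⟨le_rfl, le_rfl⟩, hle n⟩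
  have t2 := (hc (0, 0) ⟨⟨le_rfl, le_rfl⟩, ⟨le_rfl, hw0⟩⟩).tendsto.comp t3
  simp only [qsA_at_zero] at t2
  refine tendsto_nhds_unique t1 (t2.congr fun n => ?_)
  simp [h n]

/-- difference to be shown zero -/
def qsD (p a w : ℝ) : ℝ := qsB p a w - qPochInf w p * qsA p a w

lemma qsD_rec {p : ℝ} (hp0 : 0 < p) (hp1 : p < 1) {a w : ℝ} (ha : 0 ≤ a) (hw0 : 0 ≤ w)
    (hw1 : w < 1) : qsD p a w = qsD p (a * p) w - a * (1 - w) * qsD p (a * p) (p * w) := by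
  have h := qs_step hp0 hp1 w 0
  simp only [pow_zero, mul_one] at h
  unfold qsD
  rw [qsB_rec hp0 hp1 ha hw0, qsA_rec hp0 hp1 ha hw0 hw1, h, mul_comm p w]
  ring

lemma qsD_bound {p : ℝ} (hp0 : 0 < p) (hp1 : p < 1) {w0 ε : ℝ} (hw1 : w0 < 1)
    (n : ℕ) : ∀ a : ℝ, 0 ≤ a → (∀ w ∈ Set.Icc 0 w0, |qsD p (a * p ^ n) w| ≤ ε) →
      ∀ w ∈ Set.Icc 0 w0, |qsD p a w| ≤ Real.exp (a / (1 - p)) * ε := by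
  have h1p : 0 < 1 - p := by linarith
  induction n with
  | zero =>
    intro a ha h w hw
    have h1 := h w hw
    rw [pow_zero, mul_one] at h1
    have : 1 ≤ Real.exp (a / (1 - p)) := Real.one_le_exp (by positivity)
    nlinarith [abs_nonneg (qsD p a w)]
  | succ n ih =>
    intro a ha h w hw
    have hap : 0 ≤ a * p := by positivity
    have ih' := ih (a * p) hap (fun w hw => by
      have := h w hw
      rwa [pow_succ', ← mul_assoc] at this)
    have h1 := ih' w hw
    have h2 := ih' (p * w) ⟨mul_nonneg hp0.le hw.1, by nlinarith [hw.1, hw.2]⟩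
    rw [qsD_rec hp0 hp1 ha hw.1 (hw.2.trans_lt hw1)]
    set X := qsD p (a * p) w
    set Y := qsD p (a * p) (p * w)
    set M := Real.exp (a * p / (1 - p)) * ε with hM
    have hM0 : 0 ≤ M := (abs_nonneg _).trans h1
    have e1 : |a * (1 - w) * Y| ≤ a * M := by
      rw [abs_mul, abs_mul, abs_of_nonneg ha, abs_of_nonneg (by linarith [hw.2] : 0 ≤ 1 - w)]
      have : (1 - w) * |Y| ≤ M := by nlinarith [hw.1, hw.2, abs_nonneg Y]
      nlinarith
    have e2 : Real.exp (a / (1 - p)) * ε = Real.exp a * M := by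
      rw [hM, ← mul_assoc, ← Real.exp_add]
      congr 2
      field_simp
      ring
    rw [e2]
    calc |X - a * (1 - w) * Y| ≤ |X| + |a * (1 - w) * Y| := abs_sub _ _
      _ ≤ M + a * M := add_le_add h1 e1
      _ = (a + 1) * M := by ring
      _ ≤ Real.exp a * M := mul_le_mul_of_nonneg_right (Real.add_one_le_exp a) hM0

lemma qsD_zero {p : ℝ} (hp0 : 0 < p) (hp1 : p < 1) {a w : ℝ} (ha : 0 ≤ a) (hw0 : 0 ≤ w)
    (hw1 : w < 1) : qsD p a w = 0 := by
  have hc : ContinuousOn (fun x : ℝ × ℝ => qsD p x.1 x.2)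
      (Set.Icc (0:ℝ) a ×ˢ Set.Icc (0:ℝ) w) := by
    have h := (qs_cont hp0 hp1).comp (continuous_snd (X := ℝ) (Y := ℝ))
    exact (qsB_cont hp0 hp1 a w).sub (h.continuousOn.mul (qsA_cont hp0 hp1 a w hw1))
  have huc := (isCompact_Icc.prod isCompact_Icc).uniformContinuousOn_of_continuous hc
  rw [Metric.uniformContinuousOn_iff] at huc
  have key : ∀ ε > 0, |qsD p a w| ≤ Real.exp (a / (1 - p)) * ε := by
    intro ε hε
    obtain ⟨δ, hδ, H⟩ := huc ε hε
    have ht := (tendsto_pow_atTop_nhds_zero_of_lt_one hp0.le hp1).const_mul a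
    rw [mul_zero] at ht
    obtain ⟨n, hn⟩ := (ht.eventually (gt_mem_nhds hδ)).exists
    refine qsD_bound hp0 hp1 hw1 n a ha (fun v hv => ?_) w ⟨hw0, le_rfl⟩
    have hp : 0 ≤ a * p ^ n := by positivity
    have h3 := H (a * p ^ n, v) ⟨⟨hp, mul_le_of_le_one_right ha (pow_le_one₀ hp0.le hp1.le)⟩, hv⟩
      (0, v) ⟨⟨le_rfl, ha⟩, hv⟩ (by
        rw [Prod.dist_eq]
        simpa [abs_of_nonneg ha, abs_of_pos hp0, hδ] using hn)
    have h0 : qsD p 0 v = 0 := by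
      rw [qsD, qsB_at_zero, qsA_euler hp0 hp1 hv.1 (hv.2.trans_lt hw1), sub_self]
    simp only [h0, dist_zero_right] at h3
    exact h3.le
  have hE := Real.exp_pos (a / (1 - p))
  by_contra hne
  have hpos : 0 < |qsD p a w| := abs_pos.2 hne
  have := key (|qsD p a w| / (2 * Real.exp (a / (1 - p)))) (by positivity)
  have h5 : Real.exp (a / (1 - p)) * (|qsD p a w| / (2 * Real.exp (a / (1 - p))))
    = |qsD p a w| / 2 := by field_simp
  linarith

lemma qsB_ge_one {p : ℝ} (hp0 : 0 < p) (hp1 : p < 1) {W : ℝ} (hW : 0 ≤ W)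
    (hm : ∀ a : ℝ, 0 ≤ a → qsB p (a * p) W ≤ qsB p a W) {a : ℝ} (ha : 0 ≤ a) :
    1 ≤ qsB p a W := by
  have hn : ∀ n : ℕ, qsB p (a * p ^ n) W ≤ qsB p a W := by
    intro n
    induction n with
    | zero => simp
    | succ n ih =>
      refine le_trans ?_ ih
      rw [pow_succ, ← mul_assoc]
      exact hm _ (by positivity)
  have hc := qsB_cont hp0 hp1 a W
  have t3 : Tendsto (fun n : ℕ => (a * p ^ n, W)) atTop
      (𝓝[Set.Icc (0:ℝ) a ×ˢ Set.Icc (0:ℝ) W] (0, W)) := by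
    refine tendsto_nhdsWithin_iff.2 ⟨?_, Eventually.of_forall fun n => ?_⟩
    · have := (tendsto_pow_atTop_nhds_zero_of_lt_one hp0.le hp1).const_mul a
      rw [mul_zero] at this
      exact this.prodMk_nhds tendsto_const_nhds
    · exact ⟨⟨by positivity, mul_le_of_le_one_right ha (pow_le_one₀ hp0.le hp1.le)⟩,
        ⟨hW, le_rfl⟩⟩
  have t2 := (hc (0, W) ⟨⟨le_rfl, ha⟩, ⟨hW, le_rfl⟩⟩).tendsto.comp t3
  simp only [qsB_at_zero] at t2
  exact le_of_tendsto' t2 hn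

lemma qsB_pos {p : ℝ} (hp0 : 0 < p) (hp1 : p < 1) (r : ℕ) :
    ∀ a : ℝ, 0 ≤ a → 1 ≤ qsB p a ((p⁻¹) ^ r) := by
  induction r with
  | zero =>
    intro a ha
    refine qsB_ge_one hp0 hp1 (by positivity) (fun b hb => ?_) ha
    rw [qsB_rec hp0 hp1 hb (by positivity)]
    simp
  | succ r ih =>
    intro a ha
    have hw : 1 ≤ (p⁻¹) ^ (r + 1) := one_le_pow₀ ((one_le_inv₀ hp0).2 hp1.le)
    have e : p * (p⁻¹) ^ (r + 1) = (p⁻¹) ^ r := by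
      rw [pow_succ']; field_simp
    refine qsB_ge_one hp0 hp1 (by positivity) (fun b hb => ?_) ha
    rw [qsB_rec hp0 hp1 hb (by positivity), e]
    have h1 := ih (b * p) (by positivity)
    have h2 : 0 ≤ b * ((p⁻¹) ^ (r + 1) - 1) := mul_nonneg hb (by linarith)
    nlinarith

lemma qs_term {q ν z : ℝ} (hq0 : 0 < q) (hq1 : q < 1) (hz : 0 < z) (k : ℕ) :
    (1 - q ^ 2) ^ k * (z / 2) ^ (ν + 2 * k) / qPoch (q ^ 2) (q ^ 2) k * qGammaInv q (ν + k + 1)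
    = ((1 - q ^ 2) * z / 2) ^ ν / qPochInf (q ^ 2) (q ^ 2) *
      (((1 - q ^ 2) ^ 2 * z ^ 2 / 4) ^ k *
        (qPochInf (q ^ (2 * (ν + 1)) * (q ^ 2) ^ k) (q ^ 2) / qPoch (q ^ 2) (q ^ 2) k)) := by
  have h1 : 0 < 1 - q ^ 2 := by nlinarith
  have e1 : q ^ (2 * (ν + k + 1)) = q ^ (2 * (ν + 1)) * (q ^ 2) ^ k := by
    rw [← pow_mul, ← Real.rpow_natCast q (2 * k), ← Real.rpow_add hq0]
    congr 1; push_cast; ring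
  have e2 : (z / 2) ^ (ν + 2 * k) = (z / 2) ^ ν * ((z / 2) ^ 2) ^ k := by
    rw [← pow_mul, ← Real.rpow_natCast (z / 2) (2 * k), ← Real.rpow_add (by positivity)]
    congr 1; push_cast; ring
  have e3 : (1 - q ^ 2) ^ (ν + k + 1 - 1) = (1 - q ^ 2) ^ ν * (1 - q ^ 2) ^ k := by
    rw [← Real.rpow_natCast (1 - q ^ 2) k, ← Real.rpow_add h1]
    congr 1; ring
  have e4 : ((1 - q ^ 2) * z / 2) ^ ν = (1 - q ^ 2) ^ ν * (z / 2) ^ ν := by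
    rw [mul_div_assoc, Real.mul_rpow h1.le (by positivity)]
  have e5 : ((1 - q ^ 2) ^ 2 * z ^ 2 / 4) ^ k
      = (1 - q ^ 2) ^ k * (1 - q ^ 2) ^ k * ((z / 2) ^ 2) ^ k := by
    rw [← mul_pow (1 - q ^ 2) (1 - q ^ 2) k, ← mul_pow _ ((z / 2) ^ 2)]
    exact congrArg (fun t : ℝ => t ^ k) (by ring)
  rw [qGammaInv, e1, e2, e3, e4, e5]
  ring

lemma qs_I1 {q ν z : ℝ} (hq0 : 0 < q) (hq1 : q < 1) (hz : 0 < z) :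
    Iq q 1 ν z = ((1 - q ^ 2) * z / 2) ^ ν / qPochInf (q ^ 2) (q ^ 2) *
      qsA (q ^ 2) (q ^ (2 * (ν + 1))) ((1 - q ^ 2) ^ 2 * z ^ 2 / 4) := by
  rw [Iq, qsA, ← tsum_mul_left]
  refine tsum_congr fun k => ?_
  rw [← qs_term hq0 hq1 hz k]
  simp [delta]

lemma qs_I2 {q ν z : ℝ} (hq0 : 0 < q) (hq1 : q < 1) (hz : 0 < z) :
    Iq q 2 ν z = ((1 - q ^ 2) * z / 2) ^ ν / qPochInf (q ^ 2) (q ^ 2) *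
      qsB (q ^ 2) (q ^ (2 * (ν + 1))) ((1 - q ^ 2) ^ 2 * z ^ 2 / 4) := by
  rw [Iq, qsB, ← tsum_mul_left]
  refine tsum_congr fun k => ?_
  have e : q ^ ((2 - delta 2) * k * (ν + k))
      = (q ^ 2) ^ (k * (k - 1)) * (q ^ (2 * (ν + 1))) ^ k := by
    rw [← pow_mul, ← Real.rpow_natCast q, ← Real.rpow_natCast (q ^ (2 * (ν + 1))),
      ← Real.rpow_mul hq0.le, ← Real.rpow_add hq0]
    congr 1
    cases k with
    | zero => simp
    | succ k => simp [delta]; ring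
  have h := qs_term (ν := ν) hq0 hq1 hz k
  rw [e, mul_pow]
  linear_combination (q ^ 2) ^ (k * (k - 1)) * (q ^ (2 * (ν + 1))) ^ k * h

end helpers

/-- `g` extends `I_ν^{(1)}` and has a simple pole at each `z_r = 2q^{-r}/(1-q²)`. -/
theorem stmt7 (q ν : ℝ) (hq0 : 0 < q) (hq1 : q < 1) :
    (∀ z : ℝ, 0 < z → z < 2 / (1 - q ^ 2) → gfun q ν z = Iq q 1 ν z)
  ∧ ∀ r : ℕ,
      Iq q 2 ν (2 * q ^ (-(r : ℝ)) / (1 - q ^ 2)) ≠ 0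
    ∧ ∃ L : ℝ, L ≠ 0 ∧
        Filter.Tendsto
          (fun z => (z - 2 * q ^ (-(r : ℝ)) / (1 - q ^ 2)) * gfun q ν z)
          (nhdsWithin (2 * q ^ (-(r : ℝ)) / (1 - q ^ 2))
            {2 * q ^ (-(r : ℝ)) / (1 - q ^ 2)}ᶜ)
          (nhds L) := by
  have hp0 : 0 < q ^ 2 := by positivity
  have hp1 : q ^ 2 < 1 := by nlinarith
  have h1p : 0 < 1 - q ^ 2 := by linarith
  have ha : 0 < q ^ (2 * (ν + 1)) := Real.rpow_pos_of_pos hq0 _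
  have hPp : qPochInf (q ^ 2) (q ^ 2) ≠ 0 := qs_ne hp0 hp1 hp0.le hp1
  refine ⟨fun z hz0 hz1 => ?_, fun r => ?_⟩
  · have hw0 : 0 ≤ (1 - q ^ 2) ^ 2 * z ^ 2 / 4 := by positivity
    have hw1 : (1 - q ^ 2) ^ 2 * z ^ 2 / 4 < 1 := by
      rw [lt_div_iff₀ h1p] at hz1
      have : 0 < z * (1 - q ^ 2) := by positivity
      nlinarith
    have hD := qsD_zero hp0 hp1 ha.le hw0 hw1
    have hne := qs_ne hp0 hp1 hw0 hw1
    rw [gfun, qs_I1 hq0 hq1 hz0, qs_I2 hq0 hq1 hz0, div_eq_iff hne]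
    unfold qsD at hD
    rw [sub_eq_zero.1 hD]
    ring
  · set zr : ℝ := 2 * q ^ (-(r : ℝ)) / (1 - q ^ 2) with hzr
    have hqr : q ^ (-(r : ℝ)) = (q⁻¹) ^ r := by
      rw [Real.rpow_neg hq0.le, Real.rpow_natCast, inv_pow]
    have hzr0 : 0 < zr := by rw [hzr, hqr]; positivity
    have hwr : (1 - q ^ 2) ^ 2 * zr ^ 2 / 4 = ((q ^ 2)⁻¹) ^ r := by
      rw [hzr, hqr, ← inv_pow, ← pow_mul, mul_comm 2 r, pow_mul]
      field_simp
      norm_num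
    have hI : Iq q 2 ν zr ≠ 0 := by
      rw [qs_I2 hq0 hq1 hzr0, hwr]
      have := qsB_pos hp0 hp1 r _ ha.le
      have h3 : 0 < ((1 - q ^ 2) * zr / 2) ^ ν := Real.rpow_pos_of_pos (by positivity) _
      exact mul_ne_zero (div_ne_zero h3.ne' hPp) (by linarith)
    refine ⟨hI, ?_⟩
    -- continuity of I2 at zr
    have hIc : ContinuousAt (fun z => Iq q 2 ν z) zr := by
      have hev : (fun z => Iq q 2 ν z) =ᶠ[nhds zr] fun z =>
          ((1 - q ^ 2) * z / 2) ^ ν / qPochInf (q ^ 2) (q ^ 2) *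
          qsB (q ^ 2) (q ^ (2 * (ν + 1))) ((1 - q ^ 2) ^ 2 * z ^ 2 / 4) := by
        filter_upwards [lt_mem_nhds hzr0] with z hz using qs_I2 hq0 hq1 hz
      refine ContinuousAt.congr ?_ hev.symm
      have c1 : ContinuousAt (fun z : ℝ => ((1 - q ^ 2) * z / 2) ^ ν) zr :=
        ContinuousAt.rpow_const (by fun_prop) (Or.inl (by positivity))
      refine (c1.div_const _).mul ?_
      have hB := qsB_cont hp0 hp1 (q ^ (2 * (ν + 1))) ((1 - q ^ 2) ^ 2 * zr ^ 2 / 4 + 1)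
      have hm : ContinuousOn (fun w => qsB (q ^ 2) (q ^ (2 * (ν + 1))) w)
          (Set.Icc 0 ((1 - q ^ 2) ^ 2 * zr ^ 2 / 4 + 1)) :=
        hB.comp (f := fun w : ℝ => (q ^ (2 * (ν + 1)), w)) (by fun_prop)
          fun w hw => ⟨⟨ha.le, le_rfl⟩, hw⟩
      have hat : ContinuousAt (fun w => qsB (q ^ 2) (q ^ (2 * (ν + 1))) w)
          ((1 - q ^ 2) ^ 2 * zr ^ 2 / 4) :=
        hm.continuousAt (Icc_mem_nhds (by positivity) (by linarith))
      exact ContinuousAt.comp (f := fun z : ℝ => (1 - q ^ 2) ^ 2 * z ^ 2 / 4) hat (by fun_prop)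
    -- the regular part of the denominator
    set R : ℝ → ℝ := fun z => qPoch ((1 - q ^ 2) ^ 2 * z ^ 2 / 4) (q ^ 2) r *
      qPochInf ((1 - q ^ 2) ^ 2 * z ^ 2 / 4 * (q ^ 2) ^ (r + 1)) (q ^ 2) with hR
    have hRc : Continuous R := by
      have := qs_cont hp0 hp1
      have h2 : Continuous fun x => qPoch x (q ^ 2) r := by unfold qPoch; fun_prop
      have h3 := h2.comp (g := fun x => qPoch x (q ^ 2) r)
        (f := fun z : ℝ => (1 - q ^ 2) ^ 2 * z ^ 2 / 4) (by fun_prop)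
      have h4 := this.comp (f := fun z : ℝ => (1 - q ^ 2) ^ 2 * z ^ 2 / 4 * (q ^ 2) ^ (r + 1))
        (by fun_prop)
      exact h3.mul h4
    have hRne : R zr ≠ 0 := by
      simp only [hR]
      rw [hwr]
      refine mul_ne_zero ?_ ?_
      · rw [qPoch, Finset.prod_ne_zero_iff]
        intro j hj
        have hj := Finset.mem_range.1 hj
        obtain ⟨m, rfl⟩ : ∃ m, r = j + (m + 1) := ⟨r - j - 1, by omega⟩
        have e : ((q ^ 2)⁻¹) ^ (j + (m + 1)) * (q ^ 2) ^ j = ((q ^ 2)⁻¹) ^ (m + 1) := by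
          rw [pow_add, mul_right_comm, ← mul_pow, inv_mul_cancel₀ hp0.ne', one_pow, one_mul]
        rw [e]
        have : 1 < ((q ^ 2)⁻¹) ^ (m + 1) :=
          one_lt_pow₀ ((one_lt_inv₀ hp0).2 hp1) (by omega)
        linarith
      · have e : ((q ^ 2)⁻¹) ^ r * (q ^ 2) ^ (r + 1) = q ^ 2 := by
          rw [pow_succ (q ^ 2) r, ← mul_assoc, ← mul_pow, inv_mul_cancel₀ hp0.ne', one_pow, one_mul]
        rw [e]; exact hPp
    have hden : ∀ z, qPochInf ((1 - q ^ 2) ^ 2 * z ^ 2 / 4) (q ^ 2)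
        = R z * (-((z - zr) * (z + zr) / zr ^ 2)) := by
      intro z
      rw [qs_split hp0 hp1 _ (r + 1), qPoch, Finset.prod_range_succ, ← qPoch]
      have e : 1 - (1 - q ^ 2) ^ 2 * z ^ 2 / 4 * (q ^ 2) ^ r
          = -((z - zr) * (z + zr) / zr ^ 2) := by
        have h5 : (1 - q ^ 2) ^ 2 * zr ^ 2 / 4 * (q ^ 2) ^ r = 1 := by
          rw [hwr, ← mul_pow, inv_mul_cancel₀ hp0.ne', one_pow]
        have h6 : (1 - q ^ 2) ^ 2 / 4 * (q ^ 2) ^ r = 1 / zr ^ 2 := by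
          rw [eq_div_iff (by positivity)]; linarith
        have h7 : (1 - q ^ 2) ^ 2 * z ^ 2 / 4 * (q ^ 2) ^ r = z ^ 2 * (1 / zr ^ 2) := by
          rw [← h6]; ring
        rw [h7]; field_simp; ring
      rw [e]; simp only [hR]; ring
    refine ⟨Iq q 2 ν zr * (-zr ^ 2) / (R zr * (zr + zr)), ?_, ?_⟩
    · exact div_ne_zero (mul_ne_zero hI (neg_ne_zero.2 (by positivity)))
        (mul_ne_zero hRne (by positivity))
    · have hlim : ContinuousAt (fun z => Iq q 2 ν z * (-zr ^ 2) / (R z * (z + zr))) zr :=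
        (hIc.mul continuousAt_const).div (hRc.continuousAt.mul (by fun_prop))
          (mul_ne_zero hRne (by positivity))
      refine (hlim.tendsto.mono_left nhdsWithin_le_nhds).congr' ?_
      filter_upwards [self_mem_nhdsWithin] with z hz
      have hz' : z - zr ≠ 0 := sub_ne_zero.2 hz
      rw [gfun, hden z]
      by_cases hRz : R z * (z + zr) = 0
      · have : R z * (-((z - zr) * (z + zr) / zr ^ 2)) = 0 := by
          linear_combination (-(z - zr) / zr ^ 2) * hRz
        rw [hRz, this]; simp
      · have h1 := left_ne_zero_of_mul hRz
        have h2 := right_ne_zero_of_mul hRz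
        field_simp

end
end

section
/- For ν ∈ ℝ∖ℤ with Φ_ν(2/(1-q²)) ≠ 0 and Φ_{-ν}(2/(1-q²)) ≠ 0, the q-Wronskian of the functions z ↦ I_ν^{(j)}((1-q²)z;q²) and z ↦ K_ν^{(j)}((1-q²)z;q²) equals W(I_ν^{(1)}, K_ν^{(1)})(z) = (q^{-ν²}(1-q²)/2) · (a_ν/√(a_ν a_{-ν})) · e_{q²}((1-q²)² z²/4) for 0 < z < 2/(1-q²), and W(I_ν^{(2)}, K_ν^{(2)})(z) = (q^{-ν²}(1-q²)/2) · (a_ν/√(a_ν a_{-ν})) · E_{q²}(-(1-q²)² q² z²/4) for all z > 0; in particular W(I_ν^{(1)}, K_ν^{(1)})(z) ≠ 0 for 0 < z < 2/(1-q²), so that for any ν the pair (I_ν^{(j)}, K_ν^{(j)}) forms a fundamental system of solutions of the associated q-difference equation. -/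
open Real Filter

noncomputable section

/-- `Φ_ν(w) = Σ_{n≥0} (q^{ν+1/2};q)_n (q^{-ν+1/2};q)_n / ((q;q)_n (-q;q)_n) (2q/((1-q²)w))^n`. -/
def PhiNu (q ν w : ℝ) : ℝ :=
  ∑' n : ℕ, qPoch (q ^ (ν + 1/2)) q n * qPoch (q ^ (-ν + 1/2)) q n
      / (qPoch q q n * qPoch (-q) q n) * (2 * q / ((1 - q ^ 2) * w)) ^ n

/-- The coefficient `a_ν` from the Laurent-type expansion. -/
def acoef (q ν : ℝ) : ℝ :=
  Real.sqrt (2 / (1 - q ^ 2)) * Iq q 2 ν (2 / (1 - q ^ 2))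
    / (qPochInf (-1) q * PhiNu q ν (2 / (1 - q ^ 2)))

/-- The q-Macdonald function `K_ν^{(j)}((1-q²)z;q²)`, complex-valued: for `j ∈ {1,2}` it is
`(q^{-ν²+ν}/(2√(a_ν a_{-ν}))) Γ_{q²}(ν) Γ_{q²}(1-ν) [a_ν I_{-ν}^{(j)} - a_{-ν} I_ν^{(j)}]`
with the principal complex square root; for `j = 3` it is
`(1/2) q^{-ν²+ν} Γ_{q²}(ν) Γ_{q²}(1-ν) [I_{-ν}^{(3)} - I_ν^{(3)}]`. -/
def Kq (q : ℝ) (j : ℕ) (ν z : ℝ) : ℂ :=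
  if j = 3 then
    ((1 / 2 * q ^ (-ν ^ 2 + ν) * qGamma q ν * qGamma q (1 - ν)
        * (Iq q 3 (-ν) z - Iq q 3 ν z) : ℝ) : ℂ)
  else
    (((q ^ (-ν ^ 2 + ν) : ℝ) : ℂ) / (2 * ((acoef q ν * acoef q (-ν) : ℝ) : ℂ) ^ (1/2 : ℂ)))
      * ((qGamma q ν * qGamma q (1 - ν) : ℝ) : ℂ)
      * (((acoef q ν : ℝ) : ℂ) * ((Iq q j (-ν) z : ℝ) : ℂ)
          - ((acoef q (-ν) : ℝ) : ℂ) * ((Iq q j ν z : ℝ) : ℂ))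

/-- q-Wronskian of a real-valued and a complex-valued function. -/
def qWronC (q : ℝ) (f : ℝ → ℝ) (g : ℝ → ℂ) (z : ℝ) : ℂ :=
  (f z : ℂ) * g (q * z) - (f (q * z) : ℂ) * g z

section aux

lemma aux_multipliable (a : ℝ) {Q : ℝ} (h0 : 0 < Q) (h1 : Q < 1) :
    Multipliable (fun j : ℕ => 1 - a * Q ^ j) := by
  have : Summable (fun j : ℕ => -(a * Q ^ j)) :=
    ((summable_geometric_of_lt_one h0.le h1).mul_left a).neg
  simpa [sub_eq_add_neg] using Real.multipliable_one_add_of_summable this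

lemma aux_pochInf_succ (a : ℝ) {Q : ℝ} (h0 : 0 < Q) (h1 : Q < 1) :
    qPochInf a Q = (1 - a) * qPochInf (a * Q) Q := by
  unfold qPochInf
  rw [tprod_eq_zero_mul']
  · simp [pow_succ, mul_assoc, mul_comm]
  · have := aux_multipliable (a * Q) h0 h1
    simpa [pow_succ, mul_assoc, mul_comm] using this

lemma aux_tendsto (a : ℝ) {Q : ℝ} (h0 : 0 < Q) (h1 : Q < 1) :
    Tendsto (fun n => qPoch a Q n) atTop (nhds (qPochInf a Q)) :=
  (aux_multipliable a h0 h1).tendsto_prod_tprod_nat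

lemma aux_ne (a : ℝ) {Q : ℝ} (h0 : 0 < Q) (h1 : Q < 1) (h : ∀ j : ℕ, a * Q ^ j ≠ 1) :
    qPochInf a Q ≠ 0 := by
  have hs : Summable (fun j : ℕ => ‖-(a * Q ^ j)‖) :=
    ((summable_geometric_of_lt_one h0.le h1).mul_left a).neg.norm
  have := tprod_one_add_ne_zero_of_summable (f := fun j : ℕ => -(a * Q ^ j))
    (fun j => by
      have := h j
      intro h'
      apply this; linarith) hs
  simpa [sub_eq_add_neg, qPochInf] using this

lemma aux_poch_succ (a Q : ℝ) (n : ℕ) : qPoch a Q (n + 1) = qPoch a Q n * (1 - a * Q ^ n) := by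
  simp [qPoch, Finset.prod_range_succ]

lemma aux_poch_zero (a Q : ℝ) : qPoch a Q 0 = 1 := by simp [qPoch]

lemma aux_poch_mul (a : ℝ) {Q : ℝ} (h0 : 0 < Q) (h1 : Q < 1) (n : ℕ) :
    qPochInf a Q = qPoch a Q n * qPochInf (a * Q ^ n) Q := by
  induction n with
  | zero => simp [aux_poch_zero]
  | succ n ih =>
    rw [ih, aux_poch_succ, aux_pochInf_succ (a * Q ^ n) h0 h1, pow_succ]; ring_nf

lemma aux_pochQ_ne {Q : ℝ} (h0 : 0 < Q) (h1 : Q < 1) (n : ℕ) : qPoch Q Q n ≠ 0 := by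
  unfold qPoch
  refine Finset.prod_ne_zero_iff.2 fun j _ => ?_
  have : Q * Q ^ j < 1 := by
    rw [← pow_succ']; exact pow_lt_one₀ h0.le h1 (by simp)
  linarith

lemma aux_pochInfQ_ne {Q : ℝ} (h0 : 0 < Q) (h1 : Q < 1) : qPochInf Q Q ≠ 0 := by
  refine aux_ne Q h0 h1 fun j => ?_
  rw [← pow_succ']; exact (pow_lt_one₀ h0.le h1 (by simp)).ne

lemma aux_tendsto_one (a : ℝ) {Q : ℝ} (h0 : 0 < Q) (h1 : Q < 1) (h : ∀ j : ℕ, a * Q ^ j ≠ 1) :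
    Tendsto (fun n : ℕ => qPochInf (a * Q ^ n) Q) atTop (nhds 1) := by
  have hne := aux_ne a h0 h1 h
  have h2 := (tendsto_const_nhds (x := qPochInf a Q)).div (aux_tendsto a h0 h1) hne
  rw [div_self hne] at h2
  refine h2.congr fun n => ?_
  have h3 := aux_poch_mul a h0 h1 n
  have : qPoch a Q n ≠ 0 := by
    intro h'; rw [h', zero_mul] at h3; exact hne h3
  simp only [Pi.div_apply]
  rw [h3]; field_simp

lemma aux_bdd {u : ℕ → ℝ} {l : ℝ} (h : Tendsto u atTop (nhds l)) : ∃ M, ∀ n, |u n| ≤ M := by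
  obtain ⟨M, hM⟩ := (Metric.isBounded_range_of_tendsto u h).exists_norm_le
  exact ⟨M, fun n => hM _ ⟨n, rfl⟩⟩

lemma aux_summable_gauss {Q : ℝ} (h0 : 0 < Q) (h1 : Q < 1) (y : ℝ) :
    Summable (fun k : ℕ => Q ^ (k ^ 2) * y ^ k) := by
  by_cases hy : y = 0
  · subst hy
    refine summable_of_ne_finset_zero (s := {0}) fun k hk => ?_
    simp at hk; simp [hk]
  refine summable_of_ratio_test_tendsto_lt_one (l := 0) (by norm_num)
    (Eventually.of_forall fun k => by positivity) ?_
  have h2 : Tendsto (fun k : ℕ => |y| * Q * (Q ^ 2) ^ k) atTop (nhds (|y| * Q * 0)) :=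
    (tendsto_pow_atTop_nhds_zero_of_lt_one (by positivity)
      (pow_lt_one₀ h0.le h1 (by simp))).const_mul _
  rw [mul_zero] at h2
  refine h2.congr fun k => ?_
  rw [norm_mul, norm_mul, norm_pow, norm_pow, norm_pow, norm_pow, Real.norm_eq_abs, Real.norm_eq_abs,
    abs_of_pos h0, pow_succ |y|, show (k+1)^2 = k^2 + (2 * k + 1) by ring, pow_add Q, pow_add Q,
    pow_mul, pow_one]
  have : |y| ≠ 0 := by simpa
  field_simp

/-- coefficients for kind 1 -/
def cc (Q b : ℝ) (k : ℕ) : ℝ := qPochInf (b * Q ^ (k + 1)) Q / qPoch Q Q k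

/-- coefficients for kind 2 -/
def dd (Q b : ℝ) (k : ℕ) : ℝ := b ^ k * Q ^ (k ^ 2) * cc Q b k

/-- power series -/
def ps (c : ℕ → ℝ) (x : ℝ) : ℝ := ∑' k : ℕ, c k * x ^ k

lemma cc_rec {Q : ℝ} (b : ℝ) (h0 : 0 < Q) (h1 : Q < 1) (k : ℕ) :
    cc Q b (k + 1) * ((1 - Q ^ (k + 1)) * (1 - b * Q ^ (k + 1))) = cc Q b k := by
  unfold cc
  rw [aux_pochInf_succ (b * Q ^ (k + 1)) h0 h1, aux_poch_succ]
  have h2 := aux_pochQ_ne h0 h1 k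
  have h3 := aux_pochQ_ne h0 h1 (k + 1)
  rw [aux_poch_succ] at h3
  have h4 := right_ne_zero_of_mul h3
  rw [show b * Q ^ (k + 1) * Q = b * Q ^ (k + 1 + 1) by ring, show Q ^ (k+1) = Q * Q ^ k by ring]
  field_simp

lemma dd_rec {Q : ℝ} (b : ℝ) (h0 : 0 < Q) (h1 : Q < 1) (k : ℕ) :
    dd Q b (k + 1) * ((1 - Q ^ (k + 1)) * (1 - b * Q ^ (k + 1))) =
      Q * b * (Q ^ 2) ^ k * dd Q b k := by
  unfold dd
  rw [← cc_rec b h0 h1 k]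
  ring

lemma cc_tendsto {Q b : ℝ} (h0 : 0 < Q) (h1 : Q < 1) (hb : ∀ j : ℕ, b * Q ^ j ≠ 1) :
    Tendsto (cc Q b) atTop (nhds (1 / qPochInf Q Q)) := by
  have h2 := (tendsto_add_atTop_iff_nat 1).2 (aux_tendsto_one b h0 h1 hb)
  exact h2.div (aux_tendsto Q h0 h1) (aux_pochInfQ_ne h0 h1)

lemma cc_summable {Q b x : ℝ} (h0 : 0 < Q) (h1 : Q < 1) (hb : ∀ j : ℕ, b * Q ^ j ≠ 1)
    (hx0 : 0 ≤ x) (hx : x < 1) : Summable (fun k => cc Q b k * x ^ k) := by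
  obtain ⟨M, hM⟩ := aux_bdd (cc_tendsto h0 h1 hb)
  refine Summable.of_norm_bounded ((summable_geometric_of_lt_one hx0 hx).mul_left M) fun k => ?_
  rw [norm_mul, norm_pow, Real.norm_eq_abs, Real.norm_eq_abs, abs_of_nonneg hx0]
  gcongr
  exact hM k

lemma dd_summable {Q b x : ℝ} (h0 : 0 < Q) (h1 : Q < 1) (hb : ∀ j : ℕ, b * Q ^ j ≠ 1) :
    Summable (fun k => dd Q b k * x ^ k) := by
  obtain ⟨M, hM⟩ := aux_bdd (cc_tendsto h0 h1 hb)
  refine Summable.of_norm_bounded ((aux_summable_gauss h0 h1 (b * x)).norm.mul_left M) fun k => ?_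
  unfold dd
  rw [show b ^ k * Q ^ (k ^ 2) * cc Q b k * x ^ k = cc Q b k * (Q ^ (k^2) * (b * x) ^ k) by
    rw [mul_pow]; ring, norm_mul]
  gcongr
  exact hM k

lemma ps_tendsto {c : ℕ → ℝ} {Q x : ℝ} (h0 : 0 < Q) (h1 : Q < 1)
    (hs : Summable (fun k => c k * x ^ k)) :
    Tendsto (fun n : ℕ => ps c (Q ^ n * x)) atTop (nhds (c 0)) := by
  have h2 : Tendsto (fun n : ℕ => ∑' k : ℕ, c k * (Q ^ n * x) ^ k) atTop
      (nhds (∑' k : ℕ, if k = 0 then c 0 else 0)) := by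
    refine tendsto_tsum_of_dominated_convergence hs.norm ?_ ?_
    · intro k
      rcases k with _ | k
      · simp
      · have h3 : Tendsto (fun n : ℕ => Q ^ n) atTop (nhds 0) :=
          tendsto_pow_atTop_nhds_zero_of_lt_one h0.le h1
        have := ((h3.mul_const x).pow (k + 1)).const_mul (c (k + 1))
        simpa using this
    · refine Eventually.of_forall fun n k => ?_
      rw [norm_mul, norm_mul, mul_pow, norm_mul]
      have : ‖(Q ^ n) ^ k‖ ≤ 1 := by
        rw [Real.norm_eq_abs, abs_of_pos (by positivity)]
        exact pow_le_one₀ (by positivity) (pow_le_one₀ h0.le h1.le)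
      gcongr
      exact mul_le_of_le_one_left (norm_nonneg _) this
  rw [tsum_ite_eq] at h2
  exact h2

lemma summable_shrink {c : ℕ → ℝ} {Q x : ℝ} (h0 : 0 < Q) (h1 : Q < 1)
    (hs : Summable (fun k => c k * x ^ k)) : Summable (fun k => c k * (Q * x) ^ k) := by
  refine Summable.of_norm_bounded hs.norm fun k => ?_
  rw [norm_mul, norm_mul, mul_pow, norm_mul]
  have : ‖Q ^ k‖ ≤ 1 := by
    rw [Real.norm_eq_abs, abs_of_pos (by positivity)]
    exact pow_le_one₀ h0.le h1.le
  gcongr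
  exact mul_le_of_le_one_left (norm_nonneg _) this

lemma cc_eq {Q b x : ℝ} (h0 : 0 < Q) (h1 : Q < 1) (hs : Summable (fun k => cc Q b k * x ^ k)) :
    (1 - x) * ps (cc Q b) x - (1 + b) * ps (cc Q b) (Q * x) + b * ps (cc Q b) (Q * (Q * x)) = 0 := by
  have hs1 := summable_shrink h0 h1 hs
  have hs2 := summable_shrink h0 h1 hs1
  have key : ps (cc Q b) x - (1 + b) * ps (cc Q b) (Q * x) + b * ps (cc Q b) (Q * (Q * x))
      = x * ps (cc Q b) x := by
    unfold ps
    rw [← tsum_mul_left, ← tsum_mul_left, ← tsum_mul_left,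
      ← (hs.tsum_sub (hs1.mul_left _)), ← ((hs.sub (hs1.mul_left _)).tsum_add (hs2.mul_left _)),
      ((hs.sub (hs1.mul_left _)).add (hs2.mul_left _)).tsum_eq_zero_add]
    simp only [pow_zero]
    rw [show cc Q b 0 * 1 - (1 + b) * (cc Q b 0 * 1) + b * (cc Q b 0 * 1) = 0 by ring, zero_add]
    refine tsum_congr fun k => ?_
    rw [← cc_rec b h0 h1 k]
    ring
  linarith

lemma dd_eq {Q b x : ℝ} (h0 : 0 < Q) (h1 : Q < 1) (hs : Summable (fun k => dd Q b k * x ^ k)) :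
    ps (dd Q b) x - (1 + b) * ps (dd Q b) (Q * x) + b * (1 - Q * x) * ps (dd Q b) (Q * (Q * x))
      = 0 := by
  have hs1 := summable_shrink h0 h1 hs
  have hs2 := summable_shrink h0 h1 hs1
  have key : ps (dd Q b) x - (1 + b) * ps (dd Q b) (Q * x) + b * ps (dd Q b) (Q * (Q * x))
      = (Q * b * x) * ps (dd Q b) (Q * (Q * x)) := by
    unfold ps
    rw [← tsum_mul_left, ← tsum_mul_left, ← tsum_mul_left,
      ← (hs.tsum_sub (hs1.mul_left _)), ← ((hs.sub (hs1.mul_left _)).tsum_add (hs2.mul_left _)),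
      ((hs.sub (hs1.mul_left _)).add (hs2.mul_left _)).tsum_eq_zero_add]
    simp only [pow_zero]
    rw [show dd Q b 0 * 1 - (1 + b) * (dd Q b 0 * 1) + b * (dd Q b 0 * 1) = 0 by ring, zero_add]
    refine tsum_congr fun k => ?_
    have := dd_rec b h0 h1 k
    calc _ = x ^ (k+1) * (dd Q b (k + 1) * ((1 - Q ^ (k + 1)) * (1 - b * Q ^ (k + 1)))) := by ring
      _ = _ := by rw [this]; ring
  linarith

/-- normalized Wronskian -/
def UU (c c' : ℕ → ℝ) (b Q x : ℝ) : ℝ :=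
  ps c x * ps c' (Q * x) - b * ps c (Q * x) * ps c' x

lemma UU_tendsto {c c' : ℕ → ℝ} {Q b x : ℝ} (h0 : 0 < Q) (h1 : Q < 1)
    (hs : Summable (fun k => c k * x ^ k)) (hs' : Summable (fun k => c' k * x ^ k)) :
    Tendsto (fun n : ℕ => UU c c' b Q (Q ^ n * x)) atTop (nhds (c 0 * c' 0 * (1 - b))) := by
  have a1 := ps_tendsto h0 h1 hs
  have a2 := ps_tendsto h0 h1 hs'
  have b1 := (tendsto_add_atTop_iff_nat 1).2 a1
  have b2 := (tendsto_add_atTop_iff_nat 1).2 a2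
  have := (a1.mul b2).sub ((b1.const_mul b).mul a2)
  rw [show c 0 * c' 0 * (1 - b) = c 0 * c' 0 - b * c 0 * c' 0 by ring]
  refine this.congr fun n => ?_
  unfold UU
  rw [show Q * (Q ^ n * x) = Q ^ (n + 1) * x by ring]

lemma summable_pow {c : ℕ → ℝ} {Q x : ℝ} (h0 : 0 < Q) (h1 : Q < 1)
    (hs : Summable (fun k => c k * x ^ k)) (n : ℕ) : Summable (fun k => c k * (Q ^ n * x) ^ k) := by
  induction n with
  | zero => simpa using hs
  | succ n ih =>
    have := summable_shrink h0 h1 ih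
    simpa [pow_succ', mul_assoc] using this

lemma UU_cc {Q b x : ℝ} (h0 : 0 < Q) (h1 : Q < 1) (hb0 : b ≠ 0)
    (hs : Summable (fun k => cc Q b k * x ^ k)) (hs' : Summable (fun k => cc Q b⁻¹ k * x ^ k)) :
    UU (cc Q b) (cc Q b⁻¹) b Q x * qPochInf x Q = cc Q b 0 * cc Q b⁻¹ 0 * (1 - b) := by
  refine tendsto_nhds_unique ((aux_tendsto x h0 h1).const_mul _) ?_
  refine (UU_tendsto (b := b) h0 h1 hs hs').congr fun n => ?_
  induction n with
  | zero => simp [aux_poch_zero]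
  | succ n ih =>
    rw [aux_poch_succ, ← mul_assoc, ← ih]
    have e1 := cc_eq h0 h1 (summable_pow h0 h1 hs n)
    have e2 := cc_eq h0 h1 (summable_pow h0 h1 hs' n)
    rw [show Q ^ (n + 1) * x = Q * (Q ^ n * x) by ring, mul_comm x]
    generalize Q ^ n * x = y at *
    unfold UU
    have hbb : b * b⁻¹ = 1 := mul_inv_cancel₀ hb0
    have e3 : ps (cc Q b⁻¹) (Q * (Q * y)) = (b + 1) * ps (cc Q b⁻¹) (Q * y)
        - b * (1 - y) * ps (cc Q b⁻¹) y := by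
      linear_combination b * e2 - (ps (cc Q b⁻¹) (Q * (Q * y)) - ps (cc Q b⁻¹) (Q * y)) * hbb
    rw [e3]
    linear_combination (-ps (cc Q b⁻¹) (Q * y)) * e1

lemma UU_dd {Q b x : ℝ} (h0 : 0 < Q) (h1 : Q < 1) (hb0 : b ≠ 0)
    (hs : Summable (fun k => dd Q b k * x ^ k)) (hs' : Summable (fun k => dd Q b⁻¹ k * x ^ k)) :
    UU (dd Q b) (dd Q b⁻¹) b Q x = dd Q b 0 * dd Q b⁻¹ 0 * (1 - b) * qPochInf (Q * x) Q := by
  refine tendsto_nhds_unique tendsto_const_nhds (f := fun n : ℕ => UU (dd Q b) (dd Q b⁻¹) b Q x) (l := atTop) ?_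
  refine ((UU_tendsto (b := b) h0 h1 hs hs').mul (aux_tendsto (Q * x) h0 h1)).congr fun n => ?_
  induction n with
  | zero => simp [aux_poch_zero]
  | succ n ih =>
    rw [aux_poch_succ, ← ih]
    have e1 := dd_eq h0 h1 (summable_pow h0 h1 hs n)
    have e2 := dd_eq h0 h1 (summable_pow h0 h1 hs' n)
    rw [show Q ^ (n + 1) * x = Q * (Q ^ n * x) by ring, show Q * x * Q ^ n = Q * (Q ^ n * x) by ring]
    generalize Q ^ n * x = y at *
    unfold UU
    have hbb : b * b⁻¹ = 1 := mul_inv_cancel₀ hb0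
    have e3 : (1 - Q * y) * ps (dd Q b⁻¹) (Q * (Q * y)) = (b + 1) * ps (dd Q b⁻¹) (Q * y)
        - b * ps (dd Q b⁻¹) y := by
      linear_combination b * e2 -
        ((1 - Q * y) * ps (dd Q b⁻¹) (Q * (Q * y)) - ps (dd Q b⁻¹) (Q * y)) * hbb
    linear_combination qPoch (Q * x) Q n * (ps (dd Q b) (Q * y) * e3 -ps (dd Q b⁻¹) (Q * y) * e1)

lemma F_rel {Q b : ℝ} (h0 : 0 < Q) (h1 : Q < 1) (hb : ∀ j : ℕ, b * Q ^ j ≠ 1) :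
    ps (dd Q b) 1 - ps (dd Q (b * Q)) 1 =
      - (b * Q) * (ps (dd Q (b * Q)) 1 - ps (dd Q (b * Q * Q)) 1) := by
  have hb1 : ∀ j : ℕ, b * Q * Q ^ j ≠ 1 := fun j => by
    have := hb (j + 1); rwa [pow_succ', ← mul_assoc] at this
  have hb2 : ∀ j : ℕ, b * Q * Q * Q ^ j ≠ 1 := fun j => by
    have := hb1 (j + 1); rwa [pow_succ', ← mul_assoc] at this
  have s0 := dd_summable (x := 1) h0 h1 hb
  have s1 := dd_summable (x := 1) h0 h1 hb1
  have s2 := dd_summable (x := 1) h0 h1 hb2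
  have t : ∀ k, dd Q b (k+1) * 1 ^ (k+1) - dd Q (b * Q) (k+1) * 1 ^ (k+1)
      + (b * Q) * (dd Q (b * Q) (k+1) * 1 ^ (k+1)) = (b * Q) * (dd Q (b * Q * Q) k * 1 ^ k) := by
    intro k
    simp only [one_pow, mul_one]
    unfold dd cc
    rw [aux_pochInf_succ (b * Q ^ (k + 1 + 1)) h0 h1, aux_poch_succ,
      show b * Q ^ (k + 1 + 1) * Q = b * Q * Q ^ (k + 1 + 1) by ring,
      show b * Q * Q * Q ^ (k + 1) = b * Q * Q ^ (k + 1 + 1) by ring]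
    have h2 := aux_pochQ_ne h0 h1 k
    have h3 := aux_pochQ_ne h0 h1 (k + 1)
    rw [aux_poch_succ] at h3
    have h4 := right_ne_zero_of_mul h3
    field_simp
    ring
  have z : dd Q b 0 * 1 ^ 0 - dd Q (b * Q) 0 * 1 ^ 0
      + (b * Q) * (dd Q (b * Q) 0 * 1 ^ 0) = 0 := by
    unfold dd cc
    rw [aux_pochInf_succ (b * Q ^ (0 + 1)) h0 h1,
      show b * Q ^ (0 + 1) * Q = b * Q * Q ^ (0 + 1) by ring]
    simp [aux_poch_zero]
    ring
  have key : ps (dd Q b) 1 - ps (dd Q (b * Q)) 1 + (b * Q) * ps (dd Q (b * Q)) 1 =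
      (b * Q) * ps (dd Q (b * Q * Q)) 1 := by
    unfold ps
    rw [← tsum_mul_left, ← tsum_mul_left, ← (s0.tsum_sub s1),
      ← ((s0.sub s1).tsum_add (s1.mul_left _)),
      ((s0.sub s1).add (s1.mul_left _)).tsum_eq_zero_add, z, zero_add]
    exact tsum_congr t
  linarith

lemma F_tendsto {Q b : ℝ} (h0 : 0 < Q) (h1 : Q < 1) (hb : ∀ j : ℕ, b * Q ^ j ≠ 1) :
    Tendsto (fun n : ℕ => ps (dd Q (b * Q ^ n)) 1) atTop (nhds 1) := by
  obtain ⟨M, hM⟩ := aux_bdd (aux_tendsto_one b h0 h1 hb)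
  obtain ⟨N, hN⟩ := aux_bdd (cc_tendsto (b := 0) h0 h1 (by simp))
  have hP : ∀ a, qPochInf (0 * a) Q = 1 := by simp [qPochInf]
  have h2 : Tendsto (fun n : ℕ => ∑' k : ℕ, dd Q (b * Q ^ n) k * 1 ^ k) atTop
      (nhds (∑' k : ℕ, if k = 0 then (1 : ℝ) else 0)) := by
    refine tendsto_tsum_of_dominated_convergence
      (((aux_summable_gauss h0 h1 b).norm.mul_left (M * N))) ?_ ?_
    · intro k
      have h3 : Tendsto (fun n : ℕ => Q ^ n) atTop (nhds 0) :=
        tendsto_pow_atTop_nhds_zero_of_lt_one h0.le h1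
      have h4 := (tendsto_add_atTop_iff_nat (k + 1)).2 (aux_tendsto_one b h0 h1 hb)
      have h5 := ((((h3.const_mul b).pow k).mul_const (Q ^ (k ^ 2))).mul
        (h4.div_const (qPoch Q Q k))).mul_const (1 ^ k)
      have e : (b * 0) ^ k * Q ^ (k ^ 2) * (1 / qPoch Q Q k) * 1 ^ k
          = if k = 0 then (1 : ℝ) else 0 := by
        rcases k with _ | k <;> simp [aux_poch_zero]
      rw [e] at h5
      refine h5.congr fun n => ?_
      unfold dd cc
      rw [pow_add Q n (k + 1), mul_assoc b (Q ^ n) (Q ^ (k + 1))]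
    · refine Eventually.of_forall fun n k => ?_
      have hN' := hN k
      have hM' := hM (n + (k + 1))
      have hM0 : 0 ≤ M := (abs_nonneg _).trans hM'
      unfold cc at hN'
      rw [hP] at hN'
      unfold dd cc
      rw [mul_assoc b (Q ^ n) (Q ^ (k + 1)), ← pow_add,
        show (b * Q ^ n) ^ k * Q ^ k ^ 2 * (qPochInf (b * Q ^ (n + (k + 1))) Q / qPoch Q Q k) * 1 ^ k
        = (qPochInf (b * Q ^ (n + (k + 1))) Q * (1 / qPoch Q Q k)) *
          ((Q ^ n) ^ k * (Q ^ (k ^ 2) * b ^ k)) by rw [mul_pow, one_pow]; ring,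
        norm_mul, norm_mul, norm_mul ((Q ^ n) ^ k)]
      have : ‖(Q ^ n) ^ k‖ ≤ 1 := by
        rw [Real.norm_eq_abs, abs_of_pos (by positivity)]
        exact pow_le_one₀ (by positivity) (pow_le_one₀ h0.le h1.le)
      have hN0 : 0 ≤ N := (abs_nonneg _).trans hN'
      gcongr
      · exact hM'
      · exact hN'
      · exact mul_le_of_le_one_left (norm_nonneg _) this
  rw [tsum_ite_eq] at h2
  exact h2

lemma F_eq {Q b : ℝ} (h0 : 0 < Q) (h1 : Q < 1) (hb : ∀ j : ℕ, b * Q ^ j ≠ 1) :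
    ps (dd Q b) 1 = 1 := by
  have hbn : ∀ n j : ℕ, b * Q ^ n * Q ^ j ≠ 1 := fun n j => by
    rw [mul_assoc, ← pow_add]; exact hb _
  have hF := F_tendsto h0 h1 hb
  set F : ℕ → ℝ := fun n => ps (dd Q (b * Q ^ n)) 1 with hFdef
  have rel : ∀ n, F n - F (n + 1) = -(b * Q ^ n * Q) * (F (n + 1) - F (n + 2)) := fun n => by
    have := F_rel h0 h1 (hbn n)
    simp only [hFdef]
    rw [show b * Q ^ (n + 1) = b * Q ^ n * Q by ring, show b * Q ^ (n + 2) = b * Q ^ n * Q * Q by ring]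
    exact this
  -- eventually the factor is at most one half in absolute value
  have hfac : ∃ m : ℕ, ∀ n ≥ m, |F n - F (n + 1)| ≤ 1 * |F (n + 1) - F (n + 2)| := by
    have h3 : Tendsto (fun n : ℕ => |-(b * Q ^ n * Q)|) atTop (nhds |-(b * 0 * Q)|) :=
      ((((tendsto_pow_atTop_nhds_zero_of_lt_one h0.le h1).const_mul b).mul_const Q).neg).abs
    obtain ⟨m, hm⟩ := eventually_atTop.1 (h3.eventually_le_const (u := 1) (by simp))
    refine ⟨m, fun n hn => ?_⟩
    rw [rel n, abs_mul]
    exact mul_le_mul_of_nonneg_right (hm n hn) (abs_nonneg _)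
  obtain ⟨m, hm⟩ := hfac
  have hD : Tendsto (fun n => |F n - F (n + 1)|) atTop (nhds 0) := by
    have := (hF.sub ((tendsto_add_atTop_iff_nat 1).2 hF)).abs
    simpa using this
  have hz : ∀ n ≥ m, F n - F (n + 1) = 0 := by
    intro n hn
    have hle : ∀ i, |F n - F (n + 1)| ≤ |F (i + n) - F (i + n + 1)| := by
      intro i
      induction i with
      | zero => simp
      | succ i ih =>
        have := hm (i + n) (by omega)
        rw [one_mul] at this
        rw [show i + 1 + n = i + n + 1 by ring]
        exact ih.trans this
    have := ge_of_tendsto' ((tendsto_add_atTop_iff_nat n).2 hD) hle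
    exact abs_eq_zero.1 (le_antisymm this (abs_nonneg _))
  have hz' : ∀ n, F n - F (n + 1) = 0 := by
    intro n
    by_cases hn : m ≤ n
    · exact hz n hn
    · have : ∀ i ≤ m, F (m - i) - F (m - i + 1) = 0 := by
        intro i
        induction i with
        | zero => intro _; simpa using hz m le_rfl
        | succ i ih =>
          intro hi
          have h5 := ih (by omega)
          rw [rel, show m - (i + 1) + 1 = m - i by omega, show m - (i + 1) + 2 = m - i + 1 by omega,
            h5, mul_zero]
      have h6 := this (m - n) (by omega)
      rwa [show m - (m - n) = n by omega] at h6
  have hc : ∀ n, F n = F 0 := by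
    intro n
    induction n with
    | zero => rfl
    | succ n ih => have := hz' n; linarith
  have h7 : F 0 = 1 := tendsto_nhds_unique (tendsto_const_nhds.congr fun n => (hc n).symm) hF
  simpa [hFdef] using h7

end aux

section aux2

lemma Iq_one {q ν z : ℝ} (h0 : 0 < q) (h1 : q < 1) (hz : 0 < z) :
    Iq q 1 ν z = ((1 - q ^ 2) * z / 2) ^ ν / qPochInf (q ^ 2) (q ^ 2) *
      ps (cc (q ^ 2) (q ^ (2 * ν))) (((1 - q ^ 2) * z / 2) ^ 2) := by
  have hQ : 0 < 1 - q ^ 2 := by nlinarith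
  unfold Iq ps
  rw [← tsum_mul_left]
  refine tsum_congr fun k => ?_
  unfold cc qGammaInv
  rw [show (2 - delta 1) * (k : ℝ) * (ν + k) = 0 by simp [delta], rpow_zero,
    show q ^ (2 * (ν + k + 1)) = q ^ (2 * ν) * (q ^ 2) ^ (k + 1) by
      rw [← pow_mul, ← rpow_natCast q, ← rpow_add h0]; push_cast; ring_nf,
    show ν + k + 1 - 1 = ν + (k : ℝ) by ring, rpow_add hQ, rpow_natCast, rpow_add (by positivity),
    show (2 : ℝ) * k = ((2 * k : ℕ) : ℝ) by push_cast; ring, rpow_natCast,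
    mul_div_assoc (1 - q ^ 2) z 2, mul_rpow hQ.le (by positivity),
    show (((1 - q ^ 2) * (z / 2)) ^ 2) ^ k = (1 - q ^ 2) ^ k * (1 - q ^ 2) ^ k * (z / 2) ^ (2 * k) by
      rw [← pow_mul, mul_pow, two_mul, pow_add (1 - q ^ 2)]]
  generalize (1 - q ^ 2) ^ k = A
  generalize (z / 2) ^ (2 * k) = B
  ring

lemma Iq_two {q ν z : ℝ} (h0 : 0 < q) (h1 : q < 1) (hz : 0 < z) :
    Iq q 2 ν z = ((1 - q ^ 2) * z / 2) ^ ν / qPochInf (q ^ 2) (q ^ 2) *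
      ps (dd (q ^ 2) (q ^ (2 * ν))) (((1 - q ^ 2) * z / 2) ^ 2) := by
  have hQ : 0 < 1 - q ^ 2 := by nlinarith
  unfold Iq ps
  rw [← tsum_mul_left]
  refine tsum_congr fun k => ?_
  unfold dd cc qGammaInv
  rw [show q ^ ((2 - delta 2) * (k : ℝ) * (ν + k)) = (q ^ (2 * ν)) ^ k * (q ^ 2) ^ (k ^ 2) by
      rw [← pow_mul, ← rpow_natCast q, ← rpow_natCast (q ^ (2 * ν)), ← rpow_mul h0.le,
        ← rpow_add h0]; push_cast; simp only [delta]; ring_nf,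
    show q ^ (2 * (ν + k + 1)) = q ^ (2 * ν) * (q ^ 2) ^ (k + 1) by
      rw [← pow_mul, ← rpow_natCast q, ← rpow_add h0]; push_cast; ring_nf,
    show ν + k + 1 - 1 = ν + (k : ℝ) by ring, rpow_add hQ, rpow_natCast, rpow_add (by positivity),
    show (2 : ℝ) * k = ((2 * k : ℕ) : ℝ) by push_cast; ring, rpow_natCast,
    mul_div_assoc (1 - q ^ 2) z 2, mul_rpow hQ.le (by positivity),
    show (((1 - q ^ 2) * (z / 2)) ^ 2) ^ k = (1 - q ^ 2) ^ k * (1 - q ^ 2) ^ k * (z / 2) ^ (2 * k) by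
      rw [← pow_mul, mul_pow, two_mul, pow_add (1 - q ^ 2)]]
  generalize (1 - q ^ 2) ^ k = A
  generalize (z / 2) ^ (2 * k) = B
  ring

lemma b_ne {q ν : ℝ} (h0 : 0 < q) (h1 : q < 1) (hν : ∀ n : ℤ, ν ≠ n) (j : ℕ) :
    q ^ (2 * ν) * (q ^ 2) ^ j ≠ 1 := by
  rw [← pow_mul, ← rpow_natCast q, ← rpow_add h0]
  intro h
  have h3 := congrArg Real.log h
  rw [Real.log_rpow h0, Real.log_one] at h3
  have h4 := (mul_eq_zero.1 h3).resolve_right (Real.log_neg h0 h1).ne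
  apply hν (-(j : ℤ))
  push_cast at h4 ⊢
  linarith

lemma b_inv {q ν : ℝ} (h0 : 0 < q) : q ^ (2 * -ν) = (q ^ (2 * ν))⁻¹ := by
  rw [← rpow_neg h0.le]; ring_nf

lemma gamma_const {q ν : ℝ} (h0 : 0 < q) (h1 : q < 1) (hν : ∀ n : ℤ, ν ≠ n) :
    qGamma q ν * qGamma q (1 - ν) *
      (qPochInf (q ^ (2 * ν) * q ^ 2) (q ^ 2) * qPochInf ((q ^ (2 * ν))⁻¹ * q ^ 2) (q ^ 2)
        * (1 - q ^ (2 * ν))) = (1 - q ^ 2) * qPochInf (q ^ 2) (q ^ 2) ^ 2 := by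
  have hQ0 : 0 < q ^ 2 := by positivity
  have hQ1 : q ^ 2 < 1 := by nlinarith
  have hQ : 0 < 1 - q ^ 2 := by linarith
  have e1 := aux_pochInf_succ (q ^ (2 * ν)) hQ0 hQ1
  have n1 := aux_ne (q ^ (2 * ν)) hQ0 hQ1 (b_ne h0 h1 hν)
  have n2 : qPochInf ((q ^ (2 * ν))⁻¹ * q ^ 2) (q ^ 2) ≠ 0 := by
    refine aux_ne _ hQ0 hQ1 fun j => ?_
    have := b_ne h0 h1 (ν := -ν) (fun n h => hν (-n) (by push_cast; linarith)) (j + 1)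
    rwa [b_inv h0, pow_succ', ← mul_assoc] at this
  unfold qGamma
  rw [show q ^ (2 * (1 - ν)) = (q ^ (2 * ν))⁻¹ * q ^ 2 by
    rw [← b_inv h0, ← rpow_natCast q 2, ← rpow_add h0]; push_cast; ring_nf]
  have e2 : (1 - q ^ 2) ^ (1 - ν) * (1 - q ^ 2) ^ (1 - (1 - ν)) = 1 - q ^ 2 := by
    rw [← rpow_add hQ, show 1 - ν + (1 - (1 - ν)) = 1 by ring, rpow_one]
  rw [e1] at n1 ⊢
  have n3 := left_ne_zero_of_mul n1
  have n4 := right_ne_zero_of_mul n1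
  generalize (1 - q ^ 2) ^ (1 - ν) = A at *
  generalize (1 - q ^ 2) ^ (1 - (1 - ν)) = B at *
  rw [← e2]
  generalize qPochInf (q ^ (2 * ν) * q ^ 2) (q ^ 2) = X at *
  generalize qPochInf ((q ^ (2 * ν))⁻¹ * q ^ 2) (q ^ 2) = Y at *
  field_simp

lemma W_real {q ν z : ℝ} (h0 : 0 < q) (h1 : q < 1) (hz : 0 < z) (c c' : ℕ → ℝ) (I J : ℝ → ℝ)
    (hI : ∀ z, 0 < z → I z = ((1 - q ^ 2) * z / 2) ^ ν / qPochInf (q ^ 2) (q ^ 2) *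
      ps c (((1 - q ^ 2) * z / 2) ^ 2))
    (hJ : ∀ z, 0 < z → J z = ((1 - q ^ 2) * z / 2) ^ (-ν) / qPochInf (q ^ 2) (q ^ 2) *
      ps c' (((1 - q ^ 2) * z / 2) ^ 2)) :
    I z * J (q * z) - I (q * z) * J z = q ^ (-ν) / qPochInf (q ^ 2) (q ^ 2) ^ 2 *
      UU c c' (q ^ (2 * ν)) (q ^ 2) (((1 - q ^ 2) * z / 2) ^ 2) := by
  have hQ : 0 < 1 - q ^ 2 := by nlinarith
  have ht : 0 < (1 - q ^ 2) * z / 2 := by positivity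
  rw [hI z hz, hJ z hz, hI (q * z) (by positivity), hJ (q * z) (by positivity)]
  rw [show (1 - q ^ 2) * (q * z) / 2 = q * ((1 - q ^ 2) * z / 2) by ring]
  generalize (1 - q ^ 2) * z / 2 = t at *
  rw [mul_rpow h0.le ht.le, mul_rpow h0.le ht.le, mul_pow]
  have e1 : t ^ (-ν) = (t ^ ν)⁻¹ := rpow_neg ht.le _
  have e2 : q ^ (-ν) = (q ^ ν)⁻¹ := rpow_neg h0.le _
  have e3 : q ^ (2 * ν) = q ^ ν * q ^ ν := by rw [← rpow_add h0]; ring_nf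
  have p1 : t ^ ν ≠ 0 := (rpow_pos_of_pos ht _).ne'
  have p2 : q ^ ν ≠ 0 := (rpow_pos_of_pos h0 _).ne'
  unfold UU
  rw [e1, e2, e3]
  field_simp

lemma W_complex {q ν z E : ℝ} {j : ℕ} (hj : j ≠ 3) (h0 : 0 < q)
    (h : qGamma q ν * qGamma q (1 - ν) *
      (Iq q j ν z * Iq q j (-ν) (q * z) - Iq q j ν (q * z) * Iq q j (-ν) z)
      = q ^ (-ν) * (1 - q ^ 2) * E) :
    qWronC q (fun w => Iq q j ν w) (fun w => Kq q j ν w) z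
        = ((q ^ (-ν ^ 2) * (1 - q ^ 2) / 2 : ℝ) : ℂ)
            * (((acoef q ν : ℝ) : ℂ) / ((acoef q ν * acoef q (-ν) : ℝ) : ℂ) ^ (1/2 : ℂ))
            * ((E : ℝ) : ℂ) := by
  have h' : ((q ^ (-ν ^ 2 + ν) : ℝ) : ℂ) * (((qGamma q ν * qGamma q (1 - ν) : ℝ) : ℂ) *
      ((Iq q j ν z : ℂ) * (Iq q j (-ν) (q * z) : ℂ) - (Iq q j ν (q * z) : ℂ) * (Iq q j (-ν) z : ℂ)))
      = ((q ^ (-ν ^ 2) * (1 - q ^ 2) : ℝ) : ℂ) * (E : ℂ) := by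
    have : q ^ (-ν ^ 2 + ν) * (qGamma q ν * qGamma q (1 - ν) *
      (Iq q j ν z * Iq q j (-ν) (q * z) - Iq q j ν (q * z) * Iq q j (-ν) z))
      = q ^ (-ν ^ 2) * (1 - q ^ 2) * E := by
      rw [h, show -ν ^ 2 = -ν ^ 2 + ν + -ν by ring, rpow_add h0 (-ν ^ 2 + ν) (-ν)]
      ring_nf
    exact_mod_cast this
  unfold qWronC Kq
  simp only [if_neg hj]
  generalize ((acoef q ν * acoef q (-ν) : ℝ) : ℂ) ^ (1/2 : ℂ) = S at *
  push_cast at h' ⊢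
  simp only [div_eq_mul_inv, mul_inv]
  linear_combination (2⁻¹ * S⁻¹ * (acoef q ν : ℂ)) * h'

lemma acoef_ne {q ν : ℝ} (h0 : 0 < q) (h1 : q < 1) (hν : ∀ n : ℤ, ν ≠ n)
    (hP : PhiNu q ν (2 / (1 - q ^ 2)) ≠ 0) : acoef q ν ≠ 0 := by
  have hQ0 : 0 < q ^ 2 := by positivity
  have hQ1 : q ^ 2 < 1 := by nlinarith
  have hQ : 0 < 1 - q ^ 2 := by linarith
  have hz : 0 < 2 / (1 - q ^ 2) := by positivity
  unfold acoef
  rw [Iq_two h0 h1 hz, show (1 - q ^ 2) * (2 / (1 - q ^ 2)) / 2 = 1 by field_simp,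
    one_pow, F_eq hQ0 hQ1 (b_ne h0 h1 hν), one_rpow]
  have n1 := aux_pochInfQ_ne hQ0 hQ1
  have n2 : qPochInf (-1) q ≠ 0 := aux_ne _ h0 h1 fun j => by
    have := pow_pos h0 j
    linarith
  have n3 := (Real.sqrt_pos.2 hz).ne'
  refine div_ne_zero (mul_ne_zero n3 ?_) (mul_ne_zero n2 hP)
  simpa using n1

end aux2

/-- the q-Wronskians of `I_ν^{(j)}` and `K_ν^{(j)}` for `j ∈ {1,2}`;
in particular `W(I_ν^{(1)}, K_ν^{(1)})(z) ≠ 0`, so the pair forms a fundamental system.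
Here `e_{q²}(w) = 1/(w;q²)_∞` and `E_{q²}(w) = (-w;q²)_∞`. -/
theorem stmt16 (q ν : ℝ) (hq0 : 0 < q) (hq1 : q < 1) (hν : ∀ n : ℤ, ν ≠ n)
    (h1 : PhiNu q ν (2 / (1 - q ^ 2)) ≠ 0)
    (h2 : PhiNu q (-ν) (2 / (1 - q ^ 2)) ≠ 0) :
    (∀ z : ℝ, 0 < z → z < 2 / (1 - q ^ 2) →
      qWronC q (fun w => Iq q 1 ν w) (fun w => Kq q 1 ν w) z
        = ((q ^ (-ν ^ 2) * (1 - q ^ 2) / 2 : ℝ) : ℂ)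
            * (((acoef q ν : ℝ) : ℂ) / ((acoef q ν * acoef q (-ν) : ℝ) : ℂ) ^ (1/2 : ℂ))
            * (((qPochInf ((1 - q ^ 2) ^ 2 * z ^ 2 / 4) (q ^ 2))⁻¹ : ℝ) : ℂ)
      ∧ qWronC q (fun w => Iq q 1 ν w) (fun w => Kq q 1 ν w) z ≠ 0)
  ∧ ∀ z : ℝ, 0 < z →
      qWronC q (fun w => Iq q 2 ν w) (fun w => Kq q 2 ν w) z
        = ((q ^ (-ν ^ 2) * (1 - q ^ 2) / 2 : ℝ) : ℂ)
            * (((acoef q ν : ℝ) : ℂ) / ((acoef q ν * acoef q (-ν) : ℝ) : ℂ) ^ (1/2 : ℂ))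
            * ((qPochInf ((1 - q ^ 2) ^ 2 * q ^ 2 * z ^ 2 / 4) (q ^ 2) : ℝ) : ℂ) := by
  have hQ0 : 0 < q ^ 2 := by positivity
  have hQ1 : q ^ 2 < 1 := by nlinarith
  have hQ : 0 < 1 - q ^ 2 := by linarith
  have hν' : ∀ n : ℤ, -ν ≠ n := fun n h => hν (-n) (by push_cast; linarith)
  have hb := b_ne hq0 hq1 hν
  have hb' := b_ne hq0 hq1 hν'
  rw [b_inv hq0] at hb'
  have hb0 : q ^ (2 * ν) ≠ 0 := (rpow_pos_of_pos hq0 _).ne'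
  have hg := gamma_const hq0 hq1 hν
  have n1 := aux_pochInfQ_ne hQ0 hQ1
  have hcc : ∀ b, cc (q ^ 2) b 0 = qPochInf (b * q ^ 2) (q ^ 2) := by
    intro b; simp [cc, aux_poch_zero]
  have hdd : ∀ b, dd (q ^ 2) b 0 = qPochInf (b * q ^ 2) (q ^ 2) := by
    intro b; simp [dd, hcc]
  refine ⟨fun z hz hz2 => ?_, fun z hz => ?_⟩
  · have hx0 : 0 < (1 - q ^ 2) * z / 2 := by positivity
    have hx1 : (1 - q ^ 2) * z / 2 < 1 := by
      rw [lt_div_iff₀ hQ] at hz2; linarith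
    have hx2 : ((1 - q ^ 2) * z / 2) ^ 2 < 1 := pow_lt_one₀ hx0.le hx1 (by simp)
    have hU := UU_cc hQ0 hQ1 hb0 (cc_summable hQ0 hQ1 hb (by positivity) hx2)
      (cc_summable hQ0 hQ1 hb' (by positivity) hx2)
    have n2 : qPochInf (((1 - q ^ 2) * z / 2) ^ 2) (q ^ 2) ≠ 0 := by
      refine aux_ne _ hQ0 hQ1 fun j => ?_
      exact (mul_lt_one_of_nonneg_of_lt_one_left (by positivity) hx2
        (pow_le_one₀ hQ0.le hQ1.le)).ne
    have hW := W_real hq0 hq1 hz (cc (q ^ 2) (q ^ (2 * ν))) (cc (q ^ 2) (q ^ (2 * ν))⁻¹)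
      (Iq q 1 ν) (Iq q 1 (-ν)) (fun z hz => Iq_one hq0 hq1 hz)
      (fun z hz => by rw [Iq_one hq0 hq1 hz, b_inv hq0])
    have hx : (1 - q ^ 2) ^ 2 * z ^ 2 / 4 = ((1 - q ^ 2) * z / 2) ^ 2 := by ring
    have key := W_complex (q := q) (ν := ν) (z := z) (j := 1)
      (E := (qPochInf ((1 - q ^ 2) ^ 2 * z ^ 2 / 4) (q ^ 2))⁻¹) (by norm_num) hq0 (by
        rw [hW, hx, eq_mul_inv_iff_mul_eq₀ n2]
        rw [hcc, hcc] at hU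
        rw [mul_assoc, mul_assoc (_ / _), hU]
        calc _ = q ^ (-ν) / qPochInf (q ^ 2) (q ^ 2) ^ 2 * (qGamma q ν * qGamma q (1 - ν) *
      (qPochInf (q ^ (2 * ν) * q ^ 2) (q ^ 2) * qPochInf ((q ^ (2 * ν))⁻¹ * q ^ 2) (q ^ 2)
        * (1 - q ^ (2 * ν)))) := by ring
          _ = _ := by rw [hg]; field_simp)
    refine ⟨key, ?_⟩
    rw [key, hx]
    have a1 := acoef_ne hq0 hq1 hν h1
    have a2 := acoef_ne hq0 hq1 hν' h2
    refine mul_ne_zero (mul_ne_zero ?_ (div_ne_zero ?_ ?_)) ?_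
    · exact Complex.ofReal_ne_zero.2 (by have := rpow_pos_of_pos hq0 (-ν ^ 2); positivity)
    · exact Complex.ofReal_ne_zero.2 a1
    · intro h
      rw [Complex.cpow_eq_zero_iff] at h
      exact mul_ne_zero a1 a2 (Complex.ofReal_eq_zero.1 h.1)
    · exact Complex.ofReal_ne_zero.2 (inv_ne_zero n2)
  · have hU := UU_dd (x := ((1 - q ^ 2) * z / 2) ^ 2) hQ0 hQ1 hb0 (dd_summable hQ0 hQ1 hb)
      (dd_summable hQ0 hQ1 hb')
    have hW := W_real hq0 hq1 hz (dd (q ^ 2) (q ^ (2 * ν))) (dd (q ^ 2) (q ^ (2 * ν))⁻¹)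
      (Iq q 2 ν) (Iq q 2 (-ν)) (fun z hz => Iq_two hq0 hq1 hz)
      (fun z hz => by rw [Iq_two hq0 hq1 hz, b_inv hq0])
    have hx : (1 - q ^ 2) ^ 2 * q ^ 2 * z ^ 2 / 4 = q ^ 2 * ((1 - q ^ 2) * z / 2) ^ 2 := by ring
    refine W_complex (by norm_num) hq0 ?_
    rw [hW, hx, hU, hdd, hdd]
    calc _ = q ^ (-ν) / qPochInf (q ^ 2) (q ^ 2) ^ 2 * (qGamma q ν * qGamma q (1 - ν) *
      (qPochInf (q ^ (2 * ν) * q ^ 2) (q ^ 2) * qPochInf ((q ^ (2 * ν))⁻¹ * q ^ 2) (q ^ 2)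
        * (1 - q ^ (2 * ν)))) * qPochInf (q ^ 2 * ((1 - q ^ 2) * z / 2) ^ 2) (q ^ 2) := by ring
      _ = _ := by rw [hg]; field_simp

end
end
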